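/- arXiv:2509.01901 — 5 statements merged into one kernel-verified Lean document; each statement's English description precedes it below -/
import Mathlib

section
/- If G is a simple graph on n vertices with maximum degree at most 4, then the edge set of G can be partitioned into at most n-1 parts, each of which is either the edge set of a cycle in G or a single edge. Equivalently, ce(G) ≤ n-1. -/
open SimpleGraph
namespace CE
open Classical in
/-- degree -/
noncomputable def dg {V : Type*} [Fintype V] (G : SimpleGraph V) (x : V) : ℕ :=
  (Finset.univ.filter fun y => G.Adj x y).card

set_option linter.unusedSectionVars false
set_option linter.unusedTactic false
set_option linter.unusedVariables false
variable {V : Type*} [Fintype V]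

lemma dg_eq (G : SimpleGraph V) (x : V) [Fintype (G.neighborSet x)] : dg G x = G.degree x := by
  classical
  rw [dg, ← G.card_neighborFinset_eq_degree]; congr 1; ext y; simp

lemma dg_pos {G : SimpleGraph V} {x y : V} (h : G.Adj x y) : 0 < dg G x := by
  classical
  exact Finset.card_pos.mpr ⟨y, by simp [h]⟩

lemma exists_adj_of_dg_pos {G : SimpleGraph V} {x : V} (h : 0 < dg G x) : ∃ y, G.Adj x y := by
  classical
  obtain ⟨y, hy⟩ := Finset.card_pos.mp h
  exact ⟨y, by simpa using hy⟩

lemma dg_mono {G H : SimpleGraph V} (h : G ≤ H) (x : V) : dg G x ≤ dg H x := by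
  classical
  exact Finset.card_le_card fun y hy => by
    simp only [Finset.mem_filter, Finset.mem_univ, true_and] at hy ⊢; exact h hy

open Classical in
/-- Number of edges from `A` to `B`. -/
noncomputable def ed {V : Type*} (G : SimpleGraph V) (A B : Finset V) : ℕ :=
  ∑ x ∈ A, ∑ y ∈ B, if G.Adj x y then 1 else 0

lemma odd_partner (H : SimpleGraph V) (x : V) (hx : Odd (dg H x)) :
    ∃ z, z ≠ x ∧ Odd (dg H z) ∧ H.Reachable x z := by
  classical
  let H' : SimpleGraph V :=
    { Adj := fun a b => H.Adj a b ∧ H.Reachable x a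
      symm := ⟨fun a b h => ⟨h.1.symm, h.2.trans h.1.reachable⟩⟩
      loopless := ⟨fun a h => H.loopless.irrefl a h.1⟩ }
  have h1 : ∀ a, H.Reachable x a → dg H' a = dg H a := by
    intro a ha
    unfold dg
    congr 1
    ext y
    simp [H', ha]
  have h2 : Odd (H'.degree x) := by
    rw [← dg_eq, h1 x (Reachable.refl x)]; exact hx
  obtain ⟨z, hz, hz2⟩ := H'.exists_ne_odd_degree_of_exists_odd_degree x h2
  rw [← dg_eq] at hz2
  obtain ⟨y, hy⟩ := exists_adj_of_dg_pos hz2.pos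
  exact ⟨z, hz, h1 z hy.2 ▸ hz2, hy.2⟩

lemma dg_delete_edge (R : SimpleGraph V) (x y : V) (h : R.Adj x y) :
    dg (R.deleteEdges {s(x, y)}) x + 1 = dg R x := by
  classical
  unfold dg
  have : (Finset.univ.filter fun z => R.Adj x z) =
      insert y (Finset.univ.filter fun z => (R.deleteEdges {s(x, y)}).Adj x z) := by
    ext z
    simp only [Finset.mem_filter, Finset.mem_univ, true_and, Finset.mem_insert, deleteEdges_adj,
      Set.mem_singleton_iff]
    by_cases hz : z = y
    · subst hz; simp [h]
    · simp only [hz, false_or]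
      constructor
      · intro h'; refine ⟨h', ?_⟩
        intro h2
        rw [Sym2.eq_iff] at h2
        rcases h2 with h2 | h2
        · exact hz h2.2
        · exact h'.ne h2.2.symm
      · exact fun h' => h'.1
  have hn : y ∉ (Finset.univ.filter fun z => (R.deleteEdges {s(x, y)}).Adj x z) := by simp
  rw [this, Finset.card_insert_of_notMem hn]
  simp only [deleteEdges_adj, Set.mem_singleton_iff]

lemma dg_delete_edge_other (R : SimpleGraph V) (x y z : V) (h1 : z ≠ x) (h2 : z ≠ y) :
    dg (R.deleteEdges {s(x, y)}) z = dg R z := by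
  classical
  unfold dg
  congr 1
  ext w
  simp only [Finset.mem_filter, Finset.mem_univ, true_and, deleteEdges_adj,
      Set.mem_singleton_iff, Sym2.eq_iff]
  tauto

lemma exists_cycle_of_even (R : SimpleGraph V) (hR : ∀ x, Even (dg R x)) (x : V)
    (hx : 0 < dg R x) : ∃ (u : V) (w : R.Walk u u), w.IsCycle ∧ x ∈ w.support := by
  obtain ⟨y, hy⟩ := exists_adj_of_dg_pos hx
  have h1 := dg_delete_edge R x y hy
  have hodd : Odd (dg (R.deleteEdges {s(x, y)}) x) := by
    have := hR x
    rw [← h1] at this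
    by_contra hc
    rw [Nat.not_odd_iff_even] at hc
    exact (Nat.even_add_one.mp this) hc
  obtain ⟨z, hz, hz2, hz3⟩ := odd_partner _ x hodd
  have hzy : z = y := by
    by_contra hc
    rw [dg_delete_edge_other R x y z hz hc] at hz2
    exact Nat.not_even_iff_odd.mpr hz2 (hR z)
  subst hzy
  obtain ⟨u, p, hp, hp2⟩ := adj_and_reachable_delete_edges_iff_exists_cycle.mp ⟨hy, by
    simpa [deleteEdges] using hz3⟩
  exact ⟨u, p, hp, p.fst_mem_support_of_mem_edges hp2⟩

/-- edges of a walk as a set -/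
def es {G : SimpleGraph V} {u v : V} (w : G.Walk u v) : Set (Sym2 V) := {e | e ∈ w.edges}

lemma dg_delete_cycle (R : SimpleGraph V) {u : V} (w : R.Walk u u) (hw : w.IsCycle) (x : V) :
    (x ∈ w.support → dg (R.deleteEdges (es w)) x + 2 = dg R x) ∧
    (x ∉ w.support → dg (R.deleteEdges (es w)) x = dg R x) := by
  classical
  constructor
  · intro hx
    have h2 := hw.ncard_neighborSet_toSubgraph_eq_two hx
    have h3 : (w.toSubgraph.neighborSet x) =
      ((Finset.univ.filter fun z => w.toSubgraph.Adj x z : Finset V) : Set V) := by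
      ext z; simp
    rw [h3, Set.ncard_coe_finset] at h2
    unfold dg
    rw [← h2, ← Finset.card_union_of_disjoint]
    · congr 1
      ext z
      simp only [Finset.mem_union, Finset.mem_filter, Finset.mem_univ, true_and, deleteEdges_adj,
        es, Set.mem_ofPred_eq, ← Walk.mem_edges_toSubgraph, Subgraph.mem_edgeSet]
      constructor
      · rintro (h | h)
        · exact h.1
        · exact h.adj_sub
      · intro h; by_cases h' : w.toSubgraph.Adj x z
        · exact Or.inr h'
        · exact Or.inl ⟨h, h'⟩
    · rw [Finset.disjoint_left]
      intro z
      simp only [Finset.mem_filter, Finset.mem_univ, true_and, deleteEdges_adj,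
        es, Set.mem_ofPred_eq, ← Walk.mem_edges_toSubgraph, Subgraph.mem_edgeSet]
      tauto
  · intro hx
    unfold dg
    congr 1
    ext z
    simp only [Finset.mem_filter, Finset.mem_univ, true_and, deleteEdges_adj, es, Set.mem_ofPred_eq]
    constructor
    · exact fun h => h.1
    · exact fun h => ⟨h, fun h' => hx (w.fst_mem_support_of_mem_edges h')⟩

lemma card_support_cycle {R : SimpleGraph V} {u : V} (w : R.Walk u u) (hw : w.IsCycle) :
    ∃ A : Finset V, (∀ x, x ∈ A ↔ x ∈ w.support) ∧ 3 ≤ A.card := by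
  classical
  refine ⟨w.support.toFinset, by simp, ?_⟩
  have h3 := hw.three_le_length
  have h4 := hw.support_nodup
  have h5 : w.support.tail.toFinset.card = w.support.tail.length := List.toFinset_card_of_nodup h4
  have h6 : w.support.tail.toFinset ⊆ w.support.toFinset := by
    intro x; simp only [List.mem_toFinset]; exact List.mem_of_mem_tail
  have h7 := Finset.card_le_card h6
  simp [Walk.length_support] at h5
  omega

/-- cycle edge set -/
def CyP {V : Type*} (K : SimpleGraph V) (s : Set (Sym2 V)) : Prop :=
  ∃ (u : V) (w : K.Walk u u), w.IsCycle ∧ s = {e | e ∈ w.edges}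

lemma CyP.mono {K G : SimpleGraph V} (h : K ≤ G) {s : Set (Sym2 V)} (hs : CyP K s) : CyP G s := by
  obtain ⟨u, w, hw, rfl⟩ := hs
  exact ⟨u, w.mapLe h, hw.mapLe h, by rw [Walk.edges_mapLe_eq_edges]⟩

/-- peeling cycles -/
inductive Peel {V : Type*} (K : SimpleGraph V) : SimpleGraph V → List (Set (Sym2 V)) → Prop
  | nil : Peel K K []
  | cons {R : SimpleGraph V} {L : List (Set (Sym2 V))} {u : V} (w : R.Walk u u)
      (hw : w.IsCycle) (h : Peel K R L) :
      Peel K (R.deleteEdges {e | e ∈ w.edges}) ({e | e ∈ w.edges} :: L)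

lemma Peel.facts {K R : SimpleGraph V} {L : List (Set (Sym2 V))} (h : Peel K R L) :
    R ≤ K ∧ (∀ s ∈ L, CyP K s) ∧ (∀ s ∈ L, Disjoint s R.edgeSet) ∧ L.Pairwise Disjoint ∧
    (∀ e ∈ K.edgeSet, e ∈ R.edgeSet ∨ ∃ s ∈ L, e ∈ s) := by
  induction h with
  | nil => simp
  | @cons R L u w hw h ih =>
    obtain ⟨h1, h2, h3, h4, h5⟩ := ih
    have hwR : {e | e ∈ w.edges} ⊆ R.edgeSet := fun e he => w.edges_subset_edgeSet he
    refine ⟨(deleteEdges_le _).trans h1, ?_, ?_, ?_, ?_⟩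
    · intro s hs
      rcases List.mem_cons.mp hs with rfl | hs
      · exact CyP.mono h1 ⟨u, w, hw, rfl⟩
      · exact h2 s hs
    · intro s hs
      rw [edgeSet_deleteEdges]
      rcases List.mem_cons.mp hs with rfl | hs
      · exact Set.disjoint_sdiff_right
      · exact (h3 s hs).mono_right Set.sdiff_subset
    · rw [List.pairwise_cons]
      refine ⟨fun s hs => ?_, h4⟩
      exact ((h3 s hs).mono_right hwR).symm
    · intro e he
      rw [edgeSet_deleteEdges]
      rcases h5 e he with h' | ⟨s, hs, hes⟩
      · by_cases hew : e ∈ w.edges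
        · exact Or.inr ⟨_, List.mem_cons_self, hew⟩
        · exact Or.inl ⟨h', hew⟩
      · exact Or.inr ⟨s, List.mem_cons_of_mem _ hs, hes⟩

open Classical in
/-- invariant of the peeling process -/
structure PInv (K : SimpleGraph V) (u : V) (R : SimpleGraph V) (L : List (Set (Sym2 V))) : Prop where
  peel : Peel K R L
  even : ∀ x, Even (dg R x)
  reach : ∀ x, dg R x < dg K x → K.Reachable u x
  len : L.length ≤ (Finset.univ.filter fun x => dg K x = 4 ∧ dg R x = 0).card + 1
  six : 6 * L.length + ∑ x, dg R x ≤ ∑ x, dg K x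
  touch : dg R u < dg K u
  ne : L ≠ []

lemma peel_sum (R : SimpleGraph V) {u : V} (w : R.Walk u u) (hw : w.IsCycle) :
    6 + ∑ x, dg (R.deleteEdges {e | e ∈ w.edges}) x ≤ ∑ x, dg R x := by
  classical
  obtain ⟨A, hA, hA3⟩ := card_support_cycle w hw
  have h1 : ∀ x, dg R x = dg (R.deleteEdges {e | e ∈ w.edges}) x + if x ∈ A then 2 else 0 := by
    intro x
    by_cases hx : x ∈ A
    · simp only [hx, if_true]; exact ((dg_delete_cycle R w hw x).1 ((hA x).1 hx)).symm
    · simp only [hx, if_false]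
      exact ((dg_delete_cycle R w hw x).2 (fun h => hx ((hA x).2 h))).symm
  rw [Finset.sum_congr rfl (fun x _ => h1 x), Finset.sum_add_distrib]
  simp only [Finset.sum_ite_mem, Finset.univ_inter, Finset.sum_const, smul_eq_mul]
  omega

lemma peel_even (R : SimpleGraph V) (hR : ∀ x, Even (dg R x)) {u : V} (w : R.Walk u u)
    (hw : w.IsCycle) (x : V) : Even (dg (R.deleteEdges {e | e ∈ w.edges}) x) := by
  have h := dg_delete_cycle R w hw x
  have hx := hR x
  unfold es at h
  by_cases hs : x ∈ w.support
  · rw [← h.1 hs] at hx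
    exact (Nat.even_add.mp hx).mpr (by decide)
  · rw [h.2 hs]; exact hx

lemma reachable_support {K R : SimpleGraph V} (h : R ≤ K) {u x y : V} (w : R.Walk u u)
    (hx : x ∈ w.support) (hy : y ∈ w.support) : K.Reachable x y := by
  classical
  have h1 : R.Reachable u x := ⟨w.takeUntil x hx⟩
  have h2 : R.Reachable u y := ⟨w.takeUntil y hy⟩
  exact (h1.symm.trans h2).mono h

lemma peel_aux (K : SimpleGraph V) (h4 : ∀ x, dg K x ≤ 4) (hK : ∀ x, Even (dg K x)) (u : V) (m : ℕ) :
    ∀ R L, ∑ x, dg R x = m → PInv K u R L →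
    ∃ R' L', PInv K u R' L' ∧ ∀ x, dg R' x < dg K x → dg R' x = 0 := by
  classical
  induction m using Nat.strong_induction_on with
  | _ m ih =>
    intro R L hm I
    by_cases hcl : ∀ x, dg R x < dg K x → dg R x = 0
    · exact ⟨R, L, I, hcl⟩
    push Not at hcl
    obtain ⟨x, hx1, hx2⟩ := hcl
    obtain ⟨y, w, hw, hxw⟩ := exists_cycle_of_even R I.even x (Nat.pos_of_ne_zero hx2)
    have hsum := peel_sum R w hw
    have hRK := I.peel.facts.1
    have hdx := (dg_delete_cycle R w hw x).1 hxw
    have hle : ∀ z, dg (R.deleteEdges {e | e ∈ w.edges}) z ≤ dg R z := dg_mono (deleteEdges_le _)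
    unfold es at hdx
    have hx4 : dg K x = 4 ∧ dg (R.deleteEdges {e | e ∈ w.edges}) x = 0 := by
      obtain ⟨a, ha⟩ := hK x
      obtain ⟨b, hb⟩ := I.even x
      have := h4 x
      omega
    refine ih _ (by omega) _ _ rfl ⟨Peel.cons w hw I.peel, peel_even R I.even w hw, ?_, ?_, ?_, ?_, by simp⟩
    · intro z hz
      by_cases hzw : z ∈ w.support
      · exact (I.reach x hx1).trans (reachable_support hRK w hxw hzw)
      · have := (dg_delete_cycle R w hw z).2 hzw
        unfold es at this
        exact I.reach z (by omega)
    · rw [List.length_cons]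
      have := I.len
      have h2 : (Finset.univ.filter fun x => dg K x = 4 ∧ dg R x = 0).card <
        (Finset.univ.filter fun x => dg K x = 4 ∧ dg (R.deleteEdges {e | e ∈ w.edges}) x = 0).card := by
        apply Finset.card_lt_card
        rw [Finset.ssubset_iff_of_subset]
        · exact ⟨x, by simp [hx4], by simp [hx2]⟩
        · intro z
          simp only [Finset.mem_filter, Finset.mem_univ, true_and]
          intro hz
          exact ⟨hz.1, by have := hle z; omega⟩
      omega
    · rw [List.length_cons]
      have := I.six
      omega
    · exact (hle u).trans_lt I.touch

open Classical in
/-- Even graphs: peel off the component of `u`. -/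
lemma peel_exists (K : SimpleGraph V) (h4 : ∀ x, dg K x ≤ 4) (hK : ∀ x, Even (dg K x)) (u : V)
    (hu : 0 < dg K u) :
    ∃ (L : List (Set (Sym2 V))) (W : Finset V), L ≠ [] ∧ (∀ s ∈ L, CyP K s) ∧ L.Pairwise Disjoint ∧
      (∀ x, x ∈ W ↔ K.Reachable u x) ∧ (∀ x ∈ W, ∀ y, K.Adj x y → ∃ s ∈ L, s(x, y) ∈ s) ∧
      L.length ≤ (W.filter fun x => dg K x = 4).card + 1 ∧ 6 * L.length ≤ ∑ x ∈ W, dg K x := by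
  obtain ⟨y, w, hw, huw⟩ := exists_cycle_of_even K hK u hu
  have hd := (dg_delete_cycle K w hw u).1 huw
  unfold es at hd
  obtain ⟨R, L, I, hcl⟩ := peel_aux K h4 hK u _ (K.deleteEdges {e | e ∈ w.edges}) [{e | e ∈ w.edges}] rfl
    ⟨Peel.cons w hw Peel.nil, peel_even K hK w hw, by
      intro z hz
      by_cases hzw : z ∈ w.support
      · exact reachable_support le_rfl w huw hzw
      · have := (dg_delete_cycle K w hw z).2 hzw
        unfold es at this
        omega, by simp, by
      have := peel_sum K w hw
      simpa using this, by omega, by simp⟩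
  obtain ⟨f1, f2, f3, f4, f5⟩ := I.peel.facts
  have hnoadj : ∀ x, dg R x = 0 → ∀ y, ¬ R.Adj x y := fun x hx y hxy => by
    have := dg_pos hxy; omega
  have hstep : ∀ x y, K.Adj x y → dg R x < dg K x → dg R y < dg K y := by
    intro x y hxy hx
    have h0 := hnoadj x (hcl x hx) y
    apply Finset.card_lt_card
    rw [Finset.ssubset_iff_of_subset]
    · exact ⟨x, by simp [hxy.symm], by simpa using fun h => h0 h.symm⟩
    · intro z; simp only [Finset.mem_filter, Finset.mem_univ, true_and]; exact fun h => f1 h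
  have hreach : ∀ x, K.Reachable u x → dg R x < dg K x := by
    rintro x ⟨p⟩
    have : ∀ a b (q : K.Walk a b), dg R a < dg K a → dg R b < dg K b := by
      intro a b q
      induction q with
      | nil => exact id
      | cons h q ih => exact fun ha => ih (hstep _ _ h ha)
    exact this u x p I.touch
  refine ⟨L, Finset.univ.filter fun x => dg R x < dg K x, I.ne, f2, f4, ?_, ?_, ?_, ?_⟩
  · intro x
    simp only [Finset.mem_filter, Finset.mem_univ, true_and]
    exact ⟨I.reach x, hreach x⟩
  · intro x hx y hxy
    simp only [Finset.mem_filter, Finset.mem_univ, true_and] at hx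
    rcases f5 s(x, y) hxy with h | h
    · exact absurd h (hnoadj x (hcl x hx) y)
    · exact h
  · refine I.len.trans ?_
    gcongr
    intro x
    simp only [Finset.mem_filter, Finset.mem_univ, true_and]
    intro h
    omega
  · have h6 := I.six
    have h7 : ∑ x, dg K x ≤ ∑ x ∈ Finset.univ.filter (fun x => dg R x < dg K x), dg K x + ∑ x, dg R x := by
      rw [Finset.sum_filter, ← Finset.sum_add_distrib]
      apply Finset.sum_le_sum
      intro x _
      split_ifs <;> omega
    omega

/-! Flows -/

open Classical in
/-- integral unit flow of value `m` from `u` to `v` supported on `G` -/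
structure Flow (G : SimpleGraph V) (u v : V) (m : ℤ) (f : V → V → ℤ) : Prop where
  anti : ∀ x y, f x y = - f y x
  le : ∀ x y, f x y ≤ 1
  supp : ∀ x y, f x y ≠ 0 → G.Adj x y
  cons : ∀ x, ∑ y, f x y = (if x = u then m else 0) - (if x = v then m else 0)

lemma rtg_first {α : Type*} (R : α → α → Prop) (u v : α) (huv : u ≠ v) (a : α)
    (h : Relation.ReflTransGen R a v) :
    Relation.ReflTransGen (fun x y => R x y ∧ x ≠ u ∧ y ≠ u) a v ∨
      ∃ w, w ≠ u ∧ R u w ∧ Relation.ReflTransGen (fun x y => R x y ∧ x ≠ u ∧ y ≠ u) w v := by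
  induction h using Relation.ReflTransGen.head_induction_on with
  | refl => exact Or.inl .refl
  | @head a b hab hbv ih =>
    rcases ih with ih | ih
    · by_cases hb : b = u
      · subst hb
        rcases Relation.ReflTransGen.cases_head ih with h | ⟨c, h, _⟩
        · exact absurd h huv
        · exact absurd rfl h.2.1
      · by_cases ha : a = u
        · subst ha; exact Or.inr ⟨b, hb, hab, ih⟩
        · exact Or.inl (Relation.ReflTransGen.head ⟨hab, ha, hb⟩ ih)
    · exact Or.inr ih

open Classical in
/-- A directed path yields a unit flow along it. -/
lemma path_flow (n : ℕ) : ∀ (A : Finset V), A.card = n → ∀ (R : V → V → Prop) (u v : V),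
    (∀ x y, R x y → x ∈ A ∧ y ∈ A) → (∀ x, ¬ R x x) → Relation.ReflTransGen R u v →
    ∃ g : V → V → ℤ, (∀ x y, g x y = - g y x) ∧ (∀ x y, g x y ≤ 1) ∧
      (∀ x y, g x y = 1 → R x y) ∧
      (∀ x, ∑ y, g x y = (if x = u then 1 else 0) - (if x = v then 1 else 0)) := by
  induction n with
  | zero =>
    intro A hA R u v hR hirr h
    rcases Relation.ReflTransGen.cases_head h with h | ⟨c, h, _⟩
    · subst h
      exact ⟨fun _ _ => 0, by simp⟩
    · have := (hR _ _ h).1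
      rw [Finset.card_eq_zero.mp hA] at this
      simp at this
  | succ n ih =>
    intro A hA R u v hR hirr h
    by_cases huv : u = v
    · subst huv
      exact ⟨fun _ _ => 0, by simp⟩
    have hw : ∃ w, w ≠ u ∧ R u w ∧ Relation.ReflTransGen (fun x y => R x y ∧ x ≠ u ∧ y ≠ u) w v := by
      rcases rtg_first R u v huv u h with h | h
      · rcases Relation.ReflTransGen.cases_head h with h | ⟨c, h, _⟩
        · exact absurd h huv
        · exact absurd rfl h.2.1
      · exact h
    obtain ⟨w, hwu, huw, hwv⟩ := hw
    have huA := (hR _ _ huw).1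
    obtain ⟨g, g1, g2, g3, g4⟩ := ih (A.erase u) (by rw [Finset.card_erase_of_mem huA]; omega) _ w v
      (fun x y hxy => ⟨Finset.mem_erase.mpr ⟨hxy.2.1, (hR _ _ hxy.1).1⟩,
        Finset.mem_erase.mpr ⟨hxy.2.2, (hR _ _ hxy.1).2⟩⟩) (fun x hx => hirr x hx.1) hwv
    have gu : ∀ y, g u y ≠ 1 ∧ g y u ≠ 1 := fun y =>
      ⟨fun h => (g3 _ _ h).2.1 rfl, fun h => (g3 _ _ h).2.2 rfl⟩
    refine ⟨fun x y => g x y + ((if x = u ∧ y = w then 1 else 0) - (if x = w ∧ y = u then 1 else 0)),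
      ?_, ?_, ?_, ?_⟩
    · intro x y
      simp only
      rw [g1 x y]
      simp only [and_comm (b := x = w), and_comm (b := x = u)]
      ring
    · intro x y
      have := g2 x y
      simp only
      by_cases hx : x = u ∧ y = w
      · obtain ⟨rfl, rfl⟩ := hx
        have := (gu y).1
        have h3 : ¬ (x = y ∧ y = x) := fun h => hwu h.2
        simp only [and_self, if_true, h3, if_false]
        omega
      · simp only [hx, if_false]
        split_ifs <;> omega
    · intro x y
      simp only
      by_cases hx : x = u ∧ y = w
      · obtain ⟨rfl, rfl⟩ := hx
        exact fun _ => huw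
      · simp only [hx, if_false]
        by_cases hx2 : x = w ∧ y = u
        · obtain ⟨rfl, rfl⟩ := hx2
          simp only [and_self, if_true]
          have := g2 x y
          omega
        · simp only [hx2, if_false]
          intro h
          exact (g3 x y (by omega)).1
    · intro x
      rw [Finset.sum_add_distrib, g4, Finset.sum_sub_distrib]
      have e1 : ∑ y, (if x = u ∧ y = w then (1:ℤ) else 0) = if x = u then 1 else 0 := by
        by_cases hx : x = u <;> simp [hx]
      have e2 : ∑ y, (if x = w ∧ y = u then (1:ℤ) else 0) = if x = w then 1 else 0 := by
        by_cases hx : x = w <;> simp [hx]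
      rw [e1, e2]
      ring

open Classical in
lemma path_flow' (R : V → V → Prop) (u v : V) (hirr : ∀ x, ¬ R x x) (h : Relation.ReflTransGen R u v) :
    ∃ g : V → V → ℤ, (∀ x y, g x y = - g y x) ∧ (∀ x y, g x y ≤ 1) ∧
      (∀ x y, g x y = 1 → R x y) ∧
      (∀ x, ∑ y, g x y = (if x = u then 1 else 0) - (if x = v then 1 else 0)) :=
  path_flow _ Finset.univ rfl R u v (by simp) hirr h

lemma anti_sum_zero (f : V → V → ℤ) (anti : ∀ x y, f x y = - f y x) (Y : Finset V) :
    ∑ x ∈ Y, ∑ y ∈ Y, f x y = 0 := by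
  have h : ∑ x ∈ Y, ∑ y ∈ Y, f x y = - ∑ x ∈ Y, ∑ y ∈ Y, f x y := by
    conv_lhs => rw [Finset.sum_comm]
    rw [← Finset.sum_neg_distrib]
    refine Finset.sum_congr rfl fun x _ => ?_
    rw [← Finset.sum_neg_distrib]
    exact Finset.sum_congr rfl fun y _ => anti y x
  omega

open Classical in
lemma Flow.cut {G : SimpleGraph V} {u v : V} {m : ℤ} {f : V → V → ℤ} (h : Flow G u v m f)
    (Y : Finset V) (hu : u ∈ Y) (hv : v ∉ Y) : ∑ x ∈ Y, ∑ y ∈ Yᶜ, f x y = m := by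
  have h1 : ∑ x ∈ Y, ∑ y, f x y = m := by
    rw [Finset.sum_congr rfl (fun x _ => h.cons x), Finset.sum_sub_distrib]
    simp [hu, hv]
  have h2 : ∑ x ∈ Y, ∑ y, f x y = ∑ x ∈ Y, ∑ y ∈ Y, f x y + ∑ x ∈ Y, ∑ y ∈ Yᶜ, f x y := by
    rw [← Finset.sum_add_distrib]
    exact Finset.sum_congr rfl fun x _ => (Finset.sum_add_sum_compl Y _).symm
  rw [anti_sum_zero f h.anti] at h2
  omega

open Classical in
lemma flow_exists (G : SimpleGraph V) (u v : V) (huv : u ≠ v) (k : ℕ)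
    (hcut : ∀ Y : Finset V, u ∈ Y → v ∉ Y → k ≤ ed G Y Yᶜ) : ∃ f, Flow G u v k f := by
  induction k with
  | zero => exact ⟨fun _ _ => 0, ⟨by simp, by simp, by simp, by simp⟩⟩
  | succ k ih =>
    obtain ⟨f, hf⟩ := ih fun Y h1 h2 => (Nat.le_succ k).trans (hcut Y h1 h2)
    let R : V → V → Prop := fun x y => G.Adj x y ∧ f x y ≤ 0
    by_cases hr : Relation.ReflTransGen R u v
    · obtain ⟨g, g1, g2, g3, g4⟩ := path_flow' R u v (fun x hx => G.loopless.irrefl x hx.1) hr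
      refine ⟨fun x y => f x y + g x y, ⟨?_, ?_, ?_, ?_⟩⟩
      · intro x y; (try simp only); rw [hf.anti, g1]; ring
      · intro x y
        have h1 := hf.le x y
        have h2 := g2 x y
        by_cases h : g x y = 1
        · have := (g3 x y h).2; (try simp only); omega
        · (try simp only); omega
      · intro x y hxy
        by_cases h : f x y = 0
        · have h1 := g2 x y
          have h2 := g2 y x
          have h3 := g1 x y
          by_cases h4 : g x y = 1
          · exact (g3 x y h4).1
          · exact (g3 y x (by (try simp only at hxy); omega)).1.symm
        · exact hf.supp x y h
      · intro x
        rw [Finset.sum_add_distrib, hf.cons, g4]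
        push_cast
        split_ifs <;> ring
    · exfalso
      let Y : Finset V := Finset.univ.filter fun x => Relation.ReflTransGen R u x
      have huY : u ∈ Y := by simp [Y, Relation.ReflTransGen.refl]
      have hvY : v ∉ Y := by simpa [Y] using hr
      have h1 := hf.cut Y huY hvY
      have h2 := hcut Y huY hvY
      have h3 : ∑ x ∈ Y, ∑ y ∈ Yᶜ, f x y = (ed G Y Yᶜ : ℤ) := by
        unfold ed
        push_cast
        refine Finset.sum_congr rfl fun x hx => Finset.sum_congr rfl fun y hy => ?_
        simp only [Y, Finset.mem_compl, Finset.mem_filter, Finset.mem_univ, true_and] at hx hy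
        by_cases hxy : G.Adj x y
        · have : ¬ f x y ≤ 0 := fun h => hy (hx.tail ⟨hxy, h⟩)
          have := hf.le x y
          simp only [hxy, if_true]; omega
        · simp only [hxy, if_false]
          by_contra h; exact hxy (hf.supp x y h)
      omega

open Classical in
lemma Flow.reach {G : SimpleGraph V} {u v : V} {m : ℤ} {f : V → V → ℤ} (h : Flow G u v m f)
    (hm : 0 < m) : Relation.ReflTransGen (fun x y => f x y = 1) u v := by
  by_contra hr
  let Y : Finset V := Finset.univ.filter fun x => Relation.ReflTransGen (fun x y => f x y = 1) u x
  have huY : u ∈ Y := by simp [Y, Relation.ReflTransGen.refl]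
  have hvY : v ∉ Y := by simpa [Y] using hr
  have h1 := h.cut Y huY hvY
  have h3 : ∑ x ∈ Y, ∑ y ∈ Yᶜ, f x y ≤ 0 := by
    refine Finset.sum_nonpos fun x hx => Finset.sum_nonpos fun y hy => ?_
    simp only [Y, Finset.mem_compl, Finset.mem_filter, Finset.mem_univ, true_and] at hx hy
    have h4 : f x y ≠ 1 := fun h => hy (hx.tail h)
    have := h.le x y
    omega
  omega

lemma Flow.self {G : SimpleGraph V} {u v : V} {m : ℤ} {f : V → V → ℤ} (h : Flow G u v m f) (x : V) :
    f x x ≠ 1 := fun hx => G.loopless.irrefl x (h.supp x x (by omega))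

open Classical in
/-- Extract one path from a flow. -/
lemma Flow.extract {G : SimpleGraph V} {u v : V} {m : ℤ} {f : V → V → ℤ} (h : Flow G u v m f)
    (hm : 0 < m) : ∃ g, Flow G u v 1 g ∧ Flow G u v (m - 1) (fun x y => f x y - g x y) ∧
      (∀ x y, g x y ≠ 0 → f x y = g x y) := by
  obtain ⟨g, g1, g2, g3, g4⟩ := path_flow' _ u v h.self (h.reach hm)
  have key : ∀ x y, g x y ≠ 0 → f x y = g x y := by
    intro x y hxy
    have h1 := g2 x y
    have h2 := g2 y x
    have h3 := g1 x y
    have h4 := h.anti x y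
    by_cases h5 : g x y = 1
    · rw [h5]; exact g3 x y h5
    · have h6 : g y x = 1 := by omega
      have := g3 y x h6
      omega
  refine ⟨g, ⟨g1, g2, fun x y hxy => h.supp x y (by rw [key x y hxy]; exact hxy), by simpa using g4⟩,
    ⟨?_, ?_, ?_, ?_⟩, key⟩
  · intro x y; (try simp only); rw [h.anti, g1]; ring
  · intro x y
    have := h.le x y
    have h2 := key x y
    (try simp only)
    by_cases h0 : g x y = 0
    · omega
    · have := h2 h0; omega
  · intro x y hxy
    refine h.supp x y fun h0 => hxy ?_
    have h2 := key x y
    (try simp only)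
    by_cases h0 : g x y = 0
    · omega
    · have := h2 h0; omega
  · intro x
    rw [Finset.sum_sub_distrib, h.cons, g4]
    split_ifs <;> ring

/-- support graph of a flow -/
def fsupp {G : SimpleGraph V} {u v : V} {m : ℤ} {f : V → V → ℤ} (h : Flow G u v m f) :
    SimpleGraph V where
  Adj x y := f x y ≠ 0
  symm := ⟨fun x y hxy => by have := h.anti x y; omega⟩
  loopless := ⟨fun x hx => by have := h.anti x x; omega⟩

lemma fsupp_le {G : SimpleGraph V} {u v : V} {m : ℤ} {f : V → V → ℤ} (h : Flow G u v m f) :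
    fsupp h ≤ G := fun x y hxy => h.supp x y hxy

lemma fsupp_reach {G : SimpleGraph V} {u v : V} {m : ℤ} {f : V → V → ℤ} (h : Flow G u v m f)
    (hm : 0 < m) : (fsupp h).Reachable u v := by
  have h' := h.reach hm
  suffices H : ∀ b, Relation.ReflTransGen (fun x y => f x y = 1) u b → (fsupp h).Reachable u b from
    H v h'
  intro b hb
  induction hb with
  | refl => exact Reachable.refl _
  | tail _ hbc ih =>
    refine ih.trans (Adj.reachable ?_)
    change f _ _ ≠ 0
    omega

lemma fsupp_even {G : SimpleGraph V} {u v : V} {f : V → V → ℤ} (h : Flow G u v 2 f) (x : V) :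
    Even (dg (fsupp h) x) := by
  classical
  have h1 : Even (∑ y, f x y) := by
    rw [h.cons]
    split_ifs <;> decide
  have h2 : Even (((dg (fsupp h) x : ℕ) : ℤ) - ∑ y, f x y) := by
    unfold dg
    rw [Finset.card_filter]
    push_cast
    rw [← Finset.sum_sub_distrib]
    apply Finset.even_sum
    intro y _
    have e1 := h.le x y
    have e2 := h.le y x
    have e3 := h.anti x y
    have hA : (fsupp h).Adj x y ↔ f x y ≠ 0 := Iff.rfl
    simp only [hA]
    have : f x y = 0 ∨ f x y = 1 ∨ f x y = -1 := by omega
    rcases this with h | h | h <;> rw [h] <;> norm_num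
  have h3 := h2.add h1
  rw [sub_add_cancel] at h3
  exact_mod_cast h3

lemma fsupp_pos {G : SimpleGraph V} {u v : V} (huv : u ≠ v) {f : V → V → ℤ} (h : Flow G u v 2 f) :
    0 < dg (fsupp h) u ∧ 0 < dg (fsupp h) v := by
  have hr := fsupp_reach h (by norm_num)
  have aux : ∀ a b, a ≠ b → (fsupp h).Reachable a b → 0 < dg (fsupp h) a := by
    rintro a b hab ⟨p⟩
    cases p with
    | nil => exact absurd rfl hab
    | cons h _ => exact dg_pos h
  exact ⟨aux u v huv hr, aux v u huv.symm hr.symm⟩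

/-- A `4`-flow splits into two edge-disjoint `2`-flows. -/
lemma flow_split {G : SimpleGraph V} {u v : V} {f : V → V → ℤ} (h : Flow G u v 4 f) :
    ∃ f1 f2, Flow G u v 2 f1 ∧ Flow G u v 2 f2 ∧ ∀ x y, f1 x y = 0 ∨ f2 x y = 0 := by
  obtain ⟨g, hg, hfg, hk⟩ := h.extract (by norm_num)
  obtain ⟨g', hg', hfg', hk'⟩ := hfg.extract (by norm_num)
  norm_num at hfg'
  have key : ∀ x y, (g x y = 0 ∨ g' x y = 0) ∧
      ((g x y + g' x y = 0) ∨ f x y - g x y - g' x y = 0) := by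
    intro x y
    have h1 := hk x y
    have h2 := hk' x y
    by_cases h3 : g x y = 0
    · by_cases h4 : g' x y = 0
      · simp [h3, h4]
      · have := h2 h4
        (try simp only at this)
        exact ⟨Or.inl h3, Or.inr (by omega)⟩
    · have h4 := h1 h3
      by_cases h5 : g' x y = 0
      · exact ⟨Or.inr h5, Or.inr (by omega)⟩
      · have := h2 h5
        (try simp only at this)
        omega
  refine ⟨fun x y => g x y + g' x y, _, ⟨?_, ?_, ?_, ?_⟩, hfg', fun x y => (key x y).2⟩
  · intro x y; (try simp only); rw [hg.anti, hg'.anti]; ring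
  · intro x y
    have := hg.le x y
    have := hg'.le x y
    (try simp only)
    rcases (key x y).1 with h | h <;> omega
  · intro x y hxy
    by_cases h0 : g x y = 0
    · exact hg'.supp x y (by (try simp only at hxy); omega)
    · exact hg.supp x y h0
  · intro x
    rw [Finset.sum_add_distrib, hg.cons, hg'.cons]
    split_ifs <;> ring

/-! Reductions -/

/-- number of components -/
noncomputable def cc (G : SimpleGraph V) : ℕ := Nat.card G.ConnectedComponent

lemma comp_count (G G' : SimpleGraph V) (hle : G' ≤ G) (I : Finset V)
    (r : G.ConnectedComponent → V) (hr : ∀ c, G.connectedComponentMk (r c) = c)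
    (h1 : ∀ i ∈ I, ∀ c, ¬ G'.Reachable (r c) i)
    (h2 : ∀ i ∈ I, ∀ j ∈ I, i ≠ j → ¬ G'.Reachable i j) : I.card + cc G ≤ cc G' := by
  classical
  let φ : I ⊕ G.ConnectedComponent → G'.ConnectedComponent :=
    Sum.elim (fun i => G'.connectedComponentMk i.1) (fun c => G'.connectedComponentMk (r c))
  have hφ : Function.Injective φ := by
    rintro (⟨i, hi⟩ | c) (⟨j, hj⟩ | d) h
    · have := ConnectedComponent.eq.mp h
      by_contra hne
      exact h2 i hi j hj (fun h => hne (by subst h; rfl)) this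
    · exact absurd (ConnectedComponent.eq.mp h).symm (h1 i hi d)
    · exact absurd (ConnectedComponent.eq.mp h) (h1 j hj c)
    · have := (ConnectedComponent.eq.mp h).mono hle
      have := ConnectedComponent.eq.mpr this
      rw [hr, hr] at this
      rw [this]
  have := Nat.card_le_card_of_injective φ hφ
  rw [Nat.card_sum] at this
  simpa [cc] using this

/-- A part. -/
def Pt {V : Type*} (G : SimpleGraph V) (s : Set (Sym2 V)) : Prop :=
  CyP G s ∨ ∃ e ∈ G.edgeSet, s = {e}

/-- reducible graph -/
def Red (G : SimpleGraph V) : Prop :=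
  ∃ L : List (Set (Sym2 V)), L ≠ [] ∧ (∀ s ∈ L, Pt G s) ∧ L.Pairwise Disjoint ∧
    L.length + cc G ≤ cc (G.deleteEdges {e | ∃ s ∈ L, e ∈ s})

lemma red_iso (G : SimpleGraph V) (L : List (Set (Sym2 V))) (hL : L ≠ []) (hP : ∀ s ∈ L, Pt G s)
    (hD : L.Pairwise Disjoint) (u : V) (I : Finset V)
    (hiso : ∀ i ∈ I, ∀ y, G.Adj i y → ∃ s ∈ L, s(i, y) ∈ s)
    (hlen : L.length ≤ I.card) (x : V) (hx : x ∉ I) (hI : ∀ i ∈ I, G.Reachable x i) : Red G := by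
  classical
  refine ⟨L, hL, hP, hD, ?_⟩
  set G' := G.deleteEdges {e | ∃ s ∈ L, e ∈ s} with hG'
  have hno : ∀ i ∈ I, ∀ y, ¬ G'.Adj i y := by
    intro i hi y hy
    rw [hG', deleteEdges_adj] at hy
    exact hy.2 (hiso i hi y hy.1)
  have hnr : ∀ i ∈ I, ∀ y, y ≠ i → ¬ G'.Reachable i y := by
    rintro i hi y hy ⟨p⟩
    cases p with
    | nil => exact hy rfl
    | cons h _ => exact hno i hi _ h
  have := comp_count G G' (deleteEdges_le _) I
    (fun c => if c = G.connectedComponentMk x then x else Quot.out c) ?_ ?_ ?_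
  · omega
  · intro c
    split_ifs with h
    · exact h.symm
    · exact Quot.out_eq c
  · intro i hi c hc
    refine hnr i hi _ ?_ hc.symm
    split_ifs with h
    · exact fun h => hx (h ▸ hi)
    · intro h'
      apply h
      have : G.connectedComponentMk (Quot.out c) = c := Quot.out_eq c
      rw [← this, h']
      exact ConnectedComponent.eq.mpr (hI i hi).symm
  · intro i hi j hj hij
    exact hnr i hi j hij.symm

lemma dg_split {G K1 K2 : SimpleGraph V} (h1 : K1 ≤ G) (h2 : K2 ≤ G)
    (hd : ∀ x y, K1.Adj x y → ¬ K2.Adj x y) (x : V) :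
    dg K1 x + dg K2 x ≤ dg G x ∧
    (dg G x ≤ dg K1 x + dg K2 x → ∀ y, G.Adj x y → K1.Adj x y ∨ K2.Adj x y) := by
  classical
  unfold dg
  rw [← Finset.card_union_of_disjoint]
  · have hs : (Finset.univ.filter fun y => K1.Adj x y) ∪ (Finset.univ.filter fun y => K2.Adj x y) ⊆
        Finset.univ.filter fun y => G.Adj x y := by
      intro y
      simp only [Finset.mem_union, Finset.mem_filter, Finset.mem_univ, true_and]
      rintro (h | h)
      · exact h1 h
      · exact h2 h
    refine ⟨Finset.card_le_card hs, fun h y hy => ?_⟩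
    have := Finset.eq_of_subset_of_card_le hs h
    have hy' : y ∈ Finset.univ.filter fun y => G.Adj x y := by simp [hy]
    rw [← this] at hy'
    simpa using hy'
  · rw [Finset.disjoint_left]
    intro y
    simp only [Finset.mem_filter, Finset.mem_univ, true_and]
    exact hd x y

/-- Half of a reducible configuration. -/
structure Half (G K : SimpleGraph V) (u v : V) (L : List (Set (Sym2 V))) (T : Finset V) : Prop where
  le : K ≤ G
  part : ∀ s ∈ L, Pt G s
  sub : ∀ s ∈ L, s ⊆ K.edgeSet
  disj : L.Pairwise Disjoint
  four : ∀ x ∈ T, dg K x = 4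
  reach : ∀ x ∈ T, G.Reachable u x
  cov : ∀ x, x = u ∨ x = v ∨ x ∈ T → ∀ y, K.Adj x y → ∃ s ∈ L, s(x, y) ∈ s
  len : L.length ≤ T.card + 1
  pu : 0 < dg K u
  pv : 0 < dg K v

lemma red_combo {G K1 K2 : SimpleGraph V} {u v : V} {L1 L2 : List (Set (Sym2 V))} {T1 T2 : Finset V}
    (hG : ∀ x, dg G x ≤ 4) (huv : u ≠ v) (hr : G.Reachable u v)
    (H1 : Half G K1 u v L1 T1) (H2 : Half G K2 u v L2 T2) (hd : ∀ x y, K1.Adj x y → ¬ K2.Adj x y)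
    (hL1 : L1 ≠ []) (hu : dg G u ≤ dg K1 u + dg K2 u) (hv : dg G v ≤ dg K1 v + dg K2 v)
    (hex : L1.length ≤ T1.card ∨
      ∃ x, G.Reachable u x ∧ x ≠ u ∧ x ≠ v ∧ x ∉ T1 ∧ 0 < dg K1 x) : Red G := by
  classical
  have hs := dg_split H1.le H2.le hd
  have hT12 : Disjoint T1 T2 := by
    rw [Finset.disjoint_left]
    intro x h1 h2
    have := H1.four x h1
    have := H2.four x h2
    have := (hs x).1
    have := hG x
    omega
  have nT1 : ∀ x, 0 < dg K2 x → x ∉ T1 := by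
    intro x hx h1
    have := H1.four x h1
    have := (hs x).1
    have := hG x
    omega
  have nT2 : ∀ x, 0 < dg K1 x → x ∉ T2 := by
    intro x hx h1
    have := H2.four x h1
    have := (hs x).1
    have := hG x
    omega
  have hu1 := nT1 u H2.pu
  have hu2 := nT2 u H1.pu
  have hv1 := nT1 v H2.pv
  have hv2 := nT2 v H1.pv
  have hcard : (insert v (T1 ∪ T2)).card = T1.card + T2.card + 1 := by
    rw [Finset.card_insert_of_notMem (by simp [hv1, hv2]), Finset.card_union_of_disjoint hT12]
  have huI : u ∉ insert v (T1 ∪ T2) := by simp [hu1, hu2, huv]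
  have hcard2 : (insert u (insert v (T1 ∪ T2))).card = T1.card + T2.card + 2 := by
    rw [Finset.card_insert_of_notMem huI, hcard]
  have hreach : ∀ i ∈ insert u (insert v (T1 ∪ T2)), G.Reachable u i := by
    intro i hi
    simp only [Finset.mem_insert, Finset.mem_union] at hi
    rcases hi with rfl | rfl | hi | hi
    · exact Reachable.refl _
    · exact hr
    · exact H1.reach i hi
    · exact H2.reach i hi
  have hiso : ∀ i ∈ insert u (insert v (T1 ∪ T2)), ∀ y, G.Adj i y → ∃ s ∈ L1 ++ L2, s(i, y) ∈ s := by
    intro i hi y hy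
    simp only [Finset.mem_insert, Finset.mem_union] at hi
    have c1 : (i = u ∨ i = v ∨ i ∈ T1) → K1.Adj i y → ∃ s ∈ L1 ++ L2, s(i, y) ∈ s := by
      intro h h'
      obtain ⟨s, hs, h⟩ := H1.cov i h y h'
      exact ⟨s, List.mem_append_left _ hs, h⟩
    have c2 : (i = u ∨ i = v ∨ i ∈ T2) → K2.Adj i y → ∃ s ∈ L1 ++ L2, s(i, y) ∈ s := by
      intro h h'
      obtain ⟨s, hs, h⟩ := H2.cov i h y h'
      exact ⟨s, List.mem_append_right _ hs, h⟩
    have hfull : dg G i ≤ dg K1 i + dg K2 i := by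
      rcases hi with rfl | rfl | hi | hi
      · exact hu
      · exact hv
      · have := H1.four i hi; have := hG i; omega
      · have := H2.four i hi; have := hG i; omega
    rcases (hs i).2 hfull y hy with h | h
    · by_cases h2 : i ∈ T2
      · exact absurd h2 (nT2 i (dg_pos h))
      · refine c1 ?_ h
        rcases hi with hi | hi | hi | hi
        · exact Or.inl hi
        · exact Or.inr (Or.inl hi)
        · exact Or.inr (Or.inr hi)
        · exact absurd hi h2
    · by_cases h2 : i ∈ T1
      · exact absurd h2 (nT1 i (dg_pos h))
      · refine c2 ?_ h
        rcases hi with hi | hi | hi | hi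
        · exact Or.inl hi
        · exact Or.inr (Or.inl hi)
        · exact absurd hi h2
        · exact Or.inr (Or.inr hi)
  have hP : ∀ s ∈ L1 ++ L2, Pt G s := by
    intro s hs
    rcases List.mem_append.mp hs with h | h
    · exact H1.part s h
    · exact H2.part s h
  have hD : (L1 ++ L2).Pairwise Disjoint := by
    rw [List.pairwise_append]
    refine ⟨H1.disj, H2.disj, fun a ha b hb => ?_⟩
    rw [Set.disjoint_left]
    intro e h1 h2
    have e1 := H1.sub a ha h1
    have e2 := H2.sub b hb h2
    induction e with
    | _ x y => exact hd x y e1 e2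
  have l1 := H1.len
  have l2 := H2.len
  rcases hex with hex | ⟨x, hx1, hx2, hx3, hx4, hx5⟩
  · refine red_iso G (L1 ++ L2) (by simp [hL1]) hP hD u (insert v (T1 ∪ T2))
      (fun i hi => hiso i (Finset.mem_insert_of_mem hi)) ?_ u huI
      (fun i hi => hreach i (Finset.mem_insert_of_mem hi))
    rw [hcard, List.length_append]; omega
  · refine red_iso G (L1 ++ L2) (by simp [hL1]) hP hD u _ hiso ?_ x ?_
      (fun i hi => hx1.symm.trans (hreach i hi))
    · rw [hcard2, List.length_append]; omega
    · simp [hx2, hx3, hx4, nT2 x hx5]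

lemma half_of_flow {G : SimpleGraph V} (hG : ∀ x, dg G x ≤ 4) {u v : V} (huv : u ≠ v) {f : V → V → ℤ}
    (h : Flow G u v 2 f) (hu : dg (fsupp h) u = 2) (hv : dg (fsupp h) v = 2) :
    ∃ L T, Half G (fsupp h) u v L T ∧ L ≠ [] ∧ (L.length ≤ T.card ∨
      ∃ x, G.Reachable u x ∧ x ≠ u ∧ x ≠ v ∧ x ∉ T ∧ 0 < dg (fsupp h) x) := by
  classical
  have hle := fsupp_le h
  obtain ⟨L, W, h1, h2, h3, h4, h5, h6, h7⟩ := peel_exists (fsupp h)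
    (fun x => (dg_mono hle x).trans (hG x)) (fsupp_even h) u (fsupp_pos huv h).1
  have huW : u ∈ W := (h4 u).2 (Reachable.refl _)
  have hvW : v ∈ W := (h4 v).2 (fsupp_reach h (by norm_num))
  refine ⟨L, W.filter fun x => dg (fsupp h) x = 4, ⟨hle, fun s hs => Or.inl ((h2 s hs).mono hle), ?_, h3, ?_,
    ?_, ?_, h6, (fsupp_pos huv h).1, (fsupp_pos huv h).2⟩, h1, ?_⟩
  · intro s hs
    obtain ⟨a, w, _, rfl⟩ := h2 s hs
    exact fun e he => w.edges_subset_edgeSet he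
  · intro x hx; exact (Finset.mem_filter.mp hx).2
  · intro x hx; exact ((h4 x).1 (Finset.mem_filter.mp hx).1).mono hle
  · intro x hx
    apply h5
    rcases hx with rfl | rfl | hx
    · exact huW
    · exact hvW
    · exact (Finset.mem_filter.mp hx).1
  · by_cases hc : ∃ x ∈ W, x ≠ u ∧ x ≠ v ∧ dg (fsupp h) x ≠ 4
    · right
      obtain ⟨x, hxW, hxu, hxv, hx4⟩ := hc
      have hr := (h4 x).1 hxW
      refine ⟨x, hr.mono hle, hxu, hxv, by simp [hx4], ?_⟩
      obtain ⟨p⟩ := hr.symm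
      cases p with
      | nil => exact absurd rfl hxu
      | cons h _ => exact dg_pos h
    · left
      push Not at hc
      have hW : W ⊆ insert u (insert v (W.filter fun x => dg (fsupp h) x = 4)) := by
        intro x hx
        simp only [Finset.mem_insert, Finset.mem_filter]
        by_cases hxu : x = u
        · exact Or.inl hxu
        by_cases hxv : x = v
        · exact Or.inr (Or.inl hxv)
        exact Or.inr (Or.inr ⟨hx, hc x hx hxu hxv⟩)
      have hs := Finset.sum_le_sum_of_subset (f := fun x => dg (fsupp h) x) hW
      rw [Finset.sum_insert (by simp [huv, hu]), Finset.sum_insert (by simp [hv]), hu, hv,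
        Finset.sum_congr rfl (g := fun _ => 4) (fun x hx => (Finset.mem_filter.mp hx).2),
        Finset.sum_const, smul_eq_mul] at hs
      omega

/-- Two vertices of degree four joined by a flow of value four. -/
lemma red_four {G : SimpleGraph V} (hG : ∀ x, dg G x ≤ 4) {u v : V} (huv : u ≠ v)
    (hcut : ∀ Y : Finset V, u ∈ Y → v ∉ Y → 4 ≤ (by classical exact ed G Y Yᶜ)) : Red G := by
  classical
  obtain ⟨f, hf⟩ := flow_exists G u v huv 4 (fun Y h1 h2 => by convert hcut Y h1 h2)
  obtain ⟨f1, f2, F1, F2, hd⟩ := flow_split hf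
  have hd' : ∀ x y, (fsupp F1).Adj x y → ¬ (fsupp F2).Adj x y := by
    intro x y h1 h2
    rcases hd x y with h | h
    · exact h1 h
    · exact h2 h
  have hs := dg_split (fsupp_le F1) (fsupp_le F2) hd'
  have key : ∀ x, 0 < dg (fsupp F1) x → 0 < dg (fsupp F2) x →
      dg (fsupp F1) x = 2 ∧ dg (fsupp F2) x = 2 := by
    intro x p1 p2
    obtain ⟨a, ha⟩ := fsupp_even F1 x
    obtain ⟨b, hb⟩ := fsupp_even F2 x
    have := (hs x).1
    have := hG x
    omega
  have ku := key u (fsupp_pos huv F1).1 (fsupp_pos huv F2).1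
  have kv := key v (fsupp_pos huv F1).2 (fsupp_pos huv F2).2
  obtain ⟨L1, T1, H1, n1, e1⟩ := half_of_flow hG huv F1 ku.1 kv.1
  obtain ⟨L2, T2, H2, n2, e2⟩ := half_of_flow hG huv F2 ku.2 kv.2
  exact red_combo hG huv ((fsupp_reach F1 (by norm_num)).mono (fsupp_le F1)) H1 H2 hd' n1
    (by have := hG u; omega) (by have := hG v; omega) e1

/-- Two adjacent vertices of degree three joined by three edge-disjoint paths. -/
lemma red_three {G : SimpleGraph V} (hG : ∀ x, dg G x ≤ 4) {u v : V} (huv : G.Adj u v)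
    (hu : dg G u = 3) (hv : dg G v = 3)
    (hcut : ∀ Y : Finset V, u ∈ Y → v ∉ Y → 3 ≤ (by classical exact ed G Y Yᶜ)) : Red G := by
  classical
  obtain ⟨f, hf⟩ := flow_exists (G.deleteEdges {s(u, v)}) u v huv.ne 2 (by
    intro Y h1 h2
    have h3 := hcut Y h1 h2
    have h4 : ed G Y Yᶜ ≤ ed (G.deleteEdges {s(u, v)}) Y Yᶜ + 1 := by
      unfold ed
      have : ∑ x ∈ Y, ∑ y ∈ Yᶜ, (if x = u ∧ y = v then 1 else 0) ≤ 1 := by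
        have e : ∀ x ∈ Y, ∑ y ∈ Yᶜ, (if x = u ∧ y = v then 1 else 0) = if x = u then 1 else 0 := by
          intro x _
          by_cases hx : x = u <;> simp [hx, h2]
        rw [Finset.sum_congr rfl e]
        simp [h1]
      refine le_trans ?_ (Nat.add_le_add_left this _)
      rw [← Finset.sum_add_distrib]
      refine Finset.sum_le_sum fun x hx => ?_
      rw [← Finset.sum_add_distrib]
      refine Finset.sum_le_sum fun y hy => ?_
      have hxv : x ≠ v := fun h => h2 (h ▸ hx)
      by_cases hxy : G.Adj x y
      · by_cases hc : x = u ∧ y = v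
        · rw [if_pos hxy, if_pos hc]; exact Nat.le_add_left _ _
        · have : (G.deleteEdges {s(u, v)}).Adj x y := by
            rw [deleteEdges_adj]
            refine ⟨hxy, ?_⟩
            rw [Set.mem_singleton_iff, Sym2.eq_iff]
            tauto
          rw [if_pos hxy, if_pos this]; exact Nat.le_add_right _ _
      · rw [if_neg hxy]; exact Nat.zero_le _
    have h5 : 3 ≤ ed G Y Yᶜ := by convert h3
    have h6 : 2 ≤ ed (G.deleteEdges {s(u, v)}) Y Yᶜ := by omega
    convert h6)
  have F : Flow G u v 2 f := ⟨hf.anti, hf.le, fun x y h => (deleteEdges_adj.mp (hf.supp x y h)).1, hf.cons⟩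
  let K2 : SimpleGraph V := fromEdgeSet {s(u, v)}
  have hK2 : ∀ x y, K2.Adj x y ↔ s(x, y) = s(u, v) := by
    intro x y
    simp only [K2, fromEdgeSet_adj, Set.mem_singleton_iff]
    refine ⟨fun h => h.1, fun h => ⟨h, ?_⟩⟩
    rintro rfl
    rw [Sym2.eq_iff] at h
    rcases h with h | h
    · exact huv.ne (h.1.symm.trans h.2)
    · exact huv.ne (h.2.symm.trans h.1)
  have hle2 : K2 ≤ G := by
    intro x y h
    rw [hK2] at h
    rw [← mem_edgeSet, h]; exact huv
  have hd' : ∀ x y, (fsupp F).Adj x y → ¬ K2.Adj x y := by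
    intro x y h1 h2
    rw [hK2] at h2
    exact (deleteEdges_adj.mp (hf.supp x y h1)).2 h2
  have hs := dg_split (fsupp_le F) hle2 hd'
  have pu : 0 < dg K2 u := dg_pos ((hK2 u v).2 rfl)
  have pv : 0 < dg K2 v := dg_pos ((hK2 v u).2 Sym2.eq_swap)
  have key : ∀ x, dg G x = 3 → 0 < dg (fsupp F) x → 0 < dg K2 x →
      dg (fsupp F) x = 2 := by
    intro x h3 p1 p2
    obtain ⟨a, ha⟩ := fsupp_even F x
    have := (hs x).1
    omega
  have ku := key u hu (fsupp_pos huv.ne F).1 pu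
  have kv := key v hv (fsupp_pos huv.ne F).2 pv
  obtain ⟨L1, T1, H1, n1, e1⟩ := half_of_flow hG huv.ne F ku kv
  have H2 : Half G K2 u v [{s(u, v)}] ∅ := by
    refine ⟨hle2, ?_, ?_, by simp, by simp, by simp, ?_, by simp, pu, pv⟩
    · intro s hs
      rw [List.mem_singleton] at hs
      exact Or.inr ⟨s(u, v), huv, hs⟩
    · intro s hs
      rw [List.mem_singleton] at hs
      subst hs
      intro e he
      rw [Set.mem_singleton_iff] at he
      subst he
      exact (hK2 u v).2 rfl
    · intro x _ y hxy
      exact ⟨_, List.mem_singleton_self _, (hK2 x y).1 hxy⟩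
  exact red_combo hG huv.ne huv.reachable H1 H2 hd' n1 (by omega) (by omega) e1

/-! Cuts -/

lemma ed_symm (G : SimpleGraph V) (A B : Finset V) : ed G A B = ed G B A := by
  classical
  unfold ed
  rw [Finset.sum_comm]
  simp only [G.adj_comm]

open Classical in
lemma ed_union_left (G : SimpleGraph V) {A B : Finset V} (C : Finset V) (h : Disjoint A B) :
    ed G (A ∪ B) C = ed G A C + ed G B C := by
  unfold ed
  rw [Finset.sum_union h]

open Classical in
lemma ed_union_right (G : SimpleGraph V) {A B : Finset V} (C : Finset V) (h : Disjoint A B) :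
    ed G C (A ∪ B) = ed G C A + ed G C B := by
  rw [ed_symm, ed_union_left G C h, ed_symm G A, ed_symm G B]

open Classical in
lemma ed_card (G : SimpleGraph V) (A B : Finset V) :
    ed G A B = ((A ×ˢ B).filter fun p => G.Adj p.1 p.2).card := by
  unfold ed
  rw [Finset.card_filter, Finset.sum_product]

open Classical in
/-- size of the edge boundary -/
noncomputable def bd (G : SimpleGraph V) (Y : Finset V) : ℕ := ed G Y Yᶜ

open Classical in
lemma regions (G : SimpleGraph V) (S Y : Finset V) : ∃ p q r s t w : ℕ,
    bd G S = q + r + s + t ∧ bd G Y = p + r + s + w ∧ bd G (S ∩ Y) = p + q + r ∧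
    bd G (S \ Y) = p + s + t ∧ bd G (Y \ S) = q + s + w ∧ bd G (S ∪ Y)ᶜ = r + t + w := by
  set a := S ∩ Y with ha
  set b := S \ Y with hb
  set c := Y \ S with hc
  set d := (S ∪ Y)ᶜ with hd
  have ab : Disjoint a b := by
    rw [Finset.disjoint_left]; intro x; simp only [ha, hb, Finset.mem_inter, Finset.mem_sdiff]; tauto
  have ac : Disjoint a c := by
    rw [Finset.disjoint_left]; intro x; simp only [ha, hc, Finset.mem_inter, Finset.mem_sdiff]; tauto
  have bd' : Disjoint b d := by
    rw [Finset.disjoint_left]; intro x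
    simp only [hb, hd, Finset.mem_sdiff, Finset.mem_compl, Finset.mem_union]; tauto
  have cd : Disjoint c d := by
    rw [Finset.disjoint_left]; intro x
    simp only [hc, hd, Finset.mem_sdiff, Finset.mem_compl, Finset.mem_union]; tauto
  have bcd : Disjoint b (c ∪ d) := by
    rw [Finset.disjoint_left]; intro x
    simp only [hb, hc, hd, Finset.mem_sdiff, Finset.mem_compl, Finset.mem_union]; tauto
  have acd : Disjoint a (c ∪ d) := by
    rw [Finset.disjoint_left]; intro x
    simp only [ha, hc, hd, Finset.mem_sdiff, Finset.mem_compl, Finset.mem_union, Finset.mem_inter]; tauto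
  have abd : Disjoint a (b ∪ d) := by
    rw [Finset.disjoint_left]; intro x
    simp only [ha, hb, hd, Finset.mem_sdiff, Finset.mem_compl, Finset.mem_union, Finset.mem_inter]; tauto
  have abc : Disjoint a (b ∪ c) := by
    rw [Finset.disjoint_left]; intro x
    simp only [ha, hb, hc, Finset.mem_sdiff, Finset.mem_union, Finset.mem_inter]; tauto
  have bc : Disjoint b c := by
    rw [Finset.disjoint_left]; intro x; simp only [hb, hc, Finset.mem_sdiff]; tauto
  have eS : S = a ∪ b := by
    ext x; simp only [ha, hb, Finset.mem_sdiff, Finset.mem_union, Finset.mem_inter]; tauto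
  have eS' : Sᶜ = c ∪ d := by
    ext x; simp only [hc, hd, Finset.mem_sdiff, Finset.mem_union, Finset.mem_compl]; tauto
  have eY : Y = a ∪ c := by
    ext x; simp only [ha, hc, Finset.mem_sdiff, Finset.mem_union, Finset.mem_inter]; tauto
  have eY' : Yᶜ = b ∪ d := by
    ext x; simp only [hb, hd, Finset.mem_sdiff, Finset.mem_union, Finset.mem_compl]; tauto
  have ea : aᶜ = b ∪ (c ∪ d) := by
    ext x
    simp only [ha, hb, hc, hd, Finset.mem_sdiff, Finset.mem_compl, Finset.mem_union, Finset.mem_inter]; tauto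
  have eb : bᶜ = a ∪ (c ∪ d) := by
    ext x
    simp only [ha, hb, hc, hd, Finset.mem_sdiff, Finset.mem_compl, Finset.mem_union, Finset.mem_inter]; tauto
  have ec : cᶜ = a ∪ (b ∪ d) := by
    ext x
    simp only [ha, hb, hc, hd, Finset.mem_sdiff, Finset.mem_compl, Finset.mem_union, Finset.mem_inter]; tauto
  have ed' : dᶜ = a ∪ (b ∪ c) := by
    ext x
    simp only [ha, hb, hc, hd, Finset.mem_sdiff, Finset.mem_compl, Finset.mem_union, Finset.mem_inter]; tauto
  have hS : bd G S = ed G (a ∪ b) (c ∪ d) := by rw [← eS, ← eS']; rfl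
  have hY : bd G Y = ed G (a ∪ c) (b ∪ d) := by rw [← eY, ← eY']; rfl
  clear_value a b c d
  refine ⟨ed G a b, ed G a c, ed G a d, ed G b c, ed G b d, ed G c d, ?_, ?_, ?_, ?_, ?_, ?_⟩
  · rw [hS, ed_union_left G _ ab, ed_union_right G _ cd, ed_union_right G _ cd]; omega
  · rw [hY, ed_union_left G _ ac, ed_union_right G _ bd', ed_union_right G _ bd', ed_symm G c b]; omega
  · rw [bd, ea, ed_union_right G _ bcd, ed_union_right G _ cd]; omega
  · rw [bd, eb, ed_union_right G _ acd, ed_union_right G _ cd, ed_symm G b a]; omega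
  · rw [bd, ec, ed_union_right G _ abd, ed_union_right G _ bd', ed_symm G c a, ed_symm G c b]; omega
  · rw [bd, ed', ed_union_right G _ abc, ed_union_right G _ bc, ed_symm G d a, ed_symm G d b,
      ed_symm G d c]; omega

lemma closed_reach {G : SimpleGraph V} (Y : Finset V) (h : ∀ x y, x ∈ Y → G.Adj x y → y ∈ Y) {x y : V}
    (hx : x ∈ Y) (hr : G.Reachable x y) : y ∈ Y := by
  obtain ⟨p⟩ := hr
  induction p with
  | nil => exact hx
  | cons h' _ ih => exact ih (h _ _ hx h')

/-- A bridge can be removed. -/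
lemma red_bridge {G : SimpleGraph V} (Y : Finset V) (hY : bd G Y = 1) : Red G := by
  classical
  rw [bd, ed_card, Finset.card_eq_one] at hY
  obtain ⟨⟨x, y⟩, hxy⟩ := hY
  have hmem : ∀ a b, (a ∈ Y ∧ b ∉ Y) ∧ G.Adj a b ↔ a = x ∧ b = y := by
    intro a b
    have := Finset.ext_iff.mp hxy (a, b)
    simpa using this
  obtain ⟨⟨hx, hy⟩, hadj⟩ := (hmem x y).2 ⟨rfl, rfl⟩
  refine ⟨[{s(x, y)}], by simp, ?_, by simp, ?_⟩
  · intro s hs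
    rw [List.mem_singleton] at hs
    exact Or.inr ⟨s(x, y), hadj, hs⟩
  set G' := G.deleteEdges {e | ∃ s ∈ [({s(x, y)} : Set (Sym2 V))], e ∈ s} with hG'
  have hcl : ¬ G'.Reachable x y := by
    intro hr
    apply hy
    refine closed_reach Y ?_ hx hr
    intro a b ha hab
    rw [hG', deleteEdges_adj] at hab
    by_contra hb
    obtain ⟨rfl, rfl⟩ := (hmem a b).1 ⟨⟨ha, hb⟩, hab.1⟩
    exact hab.2 ⟨_, List.mem_singleton_self _, rfl⟩
  have := comp_count G G' (deleteEdges_le _) {x}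
    (fun c => if c = G.connectedComponentMk x then y else Quot.out c) ?_ ?_ ?_
  · simpa using this
  · intro c
    split_ifs with h
    · rw [h]; exact ConnectedComponent.eq.mpr hadj.symm.reachable
    · exact Quot.out_eq c
  · intro i hi c hc
    rw [Finset.mem_singleton] at hi
    subst hi
    split_ifs at hc with h
    · exact hcl hc.symm
    · apply h
      have h2 : G.connectedComponentMk (Quot.out c) = c := Quot.out_eq c
      rw [← h2]
      exact ConnectedComponent.eq.mpr (hc.mono (deleteEdges_le _))
  · intro i hi j hj hij
    rw [Finset.mem_singleton] at hi hj
    exact absurd (hi.trans hj.symm) hij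

lemma reach_of_no_bridge {G : SimpleGraph V} (hB : ∀ Y, bd G Y ≠ 1) {x y : V} (h : G.Adj x y) :
    (G.deleteEdges {s(x, y)}).Reachable x y := by
  classical
  by_contra hr
  set G' := G.deleteEdges {s(x, y)} with hG'
  apply hB (Finset.univ.filter fun z => G'.Reachable x z)
  rw [bd, ed_card, Finset.card_eq_one]
  refine ⟨(x, y), ?_⟩
  ext ⟨a, b⟩
  simp only [Finset.mem_filter, Finset.mem_product, Finset.mem_univ, true_and, Finset.mem_compl,
    Finset.mem_singleton, Prod.mk.injEq]
  constructor
  · rintro ⟨⟨ha, hb⟩, hab⟩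
    by_cases he : s(a, b) = s(x, y)
    · rcases Sym2.eq_iff.mp he with h' | ⟨rfl, rfl⟩
      · exact h'
      · exact absurd ha hr
    · exact absurd (ha.trans (Adj.reachable (deleteEdges_adj.mpr ⟨hab, he⟩))) hb
  · rintro ⟨rfl, rfl⟩
    exact ⟨⟨Reachable.refl _, hr⟩, h⟩

lemma red_two {G : SimpleGraph V} (hB : ∀ Y, bd G Y ≠ 1) {x : V} (hx : dg G x = 2) : Red G := by
  classical
  obtain ⟨y, hy⟩ := exists_adj_of_dg_pos (G := G) (x := x) (by omega)
  obtain ⟨u, p, hp, hp2⟩ := adj_and_reachable_delete_edges_iff_exists_cycle.mp ⟨hy, by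
    simpa [deleteEdges] using reach_of_no_bridge hB hy⟩
  have h0 := (dg_delete_cycle G p hp x).1 (p.fst_mem_support_of_mem_edges hp2)
  refine red_iso G [es p] (by simp) ?_ (by simp) x {x} ?_ (by simp) y (by simpa using hy.ne') ?_
  · intro s hs
    rw [List.mem_singleton] at hs
    exact Or.inl ⟨u, p, hp, hs⟩
  · intro i hi z hz
    rw [Finset.mem_singleton] at hi
    subst hi
    refine ⟨_, List.mem_singleton_self _, ?_⟩
    by_contra hc
    have := dg_pos (deleteEdges_adj.mpr ⟨hz, hc⟩)
    omega
  · intro i hi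
    rw [Finset.mem_singleton] at hi
    subst hi
    exact hy.symm.reachable

/-- admissible sets -/
def Ad (G : SimpleGraph V) (S : Finset V) : Prop :=
  S.Nonempty ∧ (∀ x ∈ S, 0 < dg G x) ∧ (bd G S ≤ 2 ∨ (bd G S ≤ 3 ∧ ∃ x ∈ S, dg G x = 4))

lemma exists_min_ad (G : SimpleGraph V) (h : ∃ x, 0 < dg G x) :
    ∃ S, Ad G S ∧ ∀ T, T ⊆ S → Ad G T → T = S := by
  classical
  have h0 : Ad G (Finset.univ.filter fun x => 0 < dg G x) := by
    obtain ⟨x, hx⟩ := h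
    refine ⟨⟨x, by simp [hx]⟩, by simp, Or.inl ?_⟩
    have : bd G (Finset.univ.filter fun x => 0 < dg G x) = 0 := by
      rw [bd, ed_card, Finset.card_eq_zero, Finset.filter_eq_empty_iff]
      rintro ⟨a, b⟩ hab hadj
      simp only [Finset.mem_product, Finset.mem_compl, Finset.mem_filter, Finset.mem_univ, true_and] at hab
      exact hab.2 (dg_pos hadj.symm)
    omega
  obtain ⟨S, hS, hmin⟩ := Finset.exists_min_image (Finset.univ.filter fun S => Ad G S) Finset.card
    ⟨_, Finset.mem_filter.mpr ⟨Finset.mem_univ _, h0⟩⟩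
  refine ⟨S, (Finset.mem_filter.mp hS).2, fun T hT hA => ?_⟩
  exact Finset.eq_of_subset_of_card_le hT (hmin T (by simp [hA]))

lemma red_main {G : SimpleGraph V} (hG : ∀ x, dg G x ≤ 4) (hne : ∃ x, 0 < dg G x) : Red G := by
  classical
  by_cases hB : ∃ Y, bd G Y = 1
  · obtain ⟨Y, hY⟩ := hB
    exact red_bridge Y hY
  push Not at hB
  by_cases h2 : ∃ x, dg G x = 2
  · obtain ⟨x, hx⟩ := h2
    exact red_two hB hx
  push Not at h2
  obtain ⟨S, ⟨hSne, hSpos, hSb⟩, hmin⟩ := exists_min_ad G hne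
  have hrow : ∀ x, (∑ y ∈ S, if G.Adj x y then 1 else 0) +
      (∑ y ∈ Sᶜ, if G.Adj x y then 1 else 0) = dg G x := by
    intro x
    rw [Finset.sum_add_sum_compl, dg, Finset.card_filter]
  have h1 : ∀ x, dg G x ≠ 1 := by
    intro x hx
    apply hB {x}
    have e : bd G {x} + (if G.Adj x x then 1 else 0) = dg G x := by
      rw [bd, ed, Finset.sum_singleton, dg, Finset.card_filter,
        ← Finset.sum_add_sum_compl {x}, Finset.sum_singleton, add_comm]
    rw [if_neg (G.loopless.irrefl x)] at e
    omega
  have h34 : ∀ x ∈ S, dg G x = 3 ∨ dg G x = 4 := by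
    intro x hx
    have := hSpos x hx
    have := hG x
    have := h1 x
    have := h2 x
    omega
  have hmin2 : ∀ T, T ⊆ S → T.Nonempty → T ≠ S → 3 ≤ bd G T := by
    intro T hT hTn hTS
    by_contra hc
    exact hTS (hmin T hT ⟨hTn, fun x hx => hSpos x (hT hx), Or.inl (by omega)⟩)
  have hmin3 : ∀ T, T ⊆ S → T ≠ S → (∃ x ∈ T, dg G x = 4) → 4 ≤ bd G T := by
    rintro T hT hTS ⟨x, hx, hx4⟩
    by_contra hc
    exact hTS (hmin T hT ⟨⟨x, hx⟩, fun x hx => hSpos x (hT hx), Or.inr ⟨by omega, x, hx, hx4⟩⟩)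
  have hS3 : bd G S ≤ 3 := by omega
  by_cases hfour : ∃ u ∈ S, ∃ v ∈ S, u ≠ v ∧ dg G u = 4 ∧ dg G v = 4
  · obtain ⟨u, hu, v, hv, huv, hu4, hv4⟩ := hfour
    refine red_four hG huv fun Y hY1 hY2 => ?_
    by_contra hc
    have hc' : bd G Y ≤ 3 := by
      have : ¬ 4 ≤ bd G Y := by rw [bd]; convert hc
      omega
    obtain ⟨p, q, r, s, t, w, e1, e2, e3, e4, e5, e6⟩ := regions G S Y
    have m1 := hmin3 (S ∩ Y) Finset.inter_subset_left
      (fun h => hY2 (Finset.mem_inter.mp (h ▸ hv)).2) ⟨u, Finset.mem_inter.mpr ⟨hu, hY1⟩, hu4⟩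
    have m2 := hmin3 (S \ Y) Finset.sdiff_subset
      (fun h => (Finset.mem_sdiff.mp (h ▸ hu)).2 hY1) ⟨v, Finset.mem_sdiff.mpr ⟨hv, hY2⟩, hv4⟩
    have b1 := hB (Y \ S)
    have b2 := hB (S ∪ Y)ᶜ
    omega
  by_cases hthree : ∃ u ∈ S, ∃ v ∈ S, G.Adj u v ∧ dg G u = 3 ∧ dg G v = 3
  · obtain ⟨u, hu, v, hv, huv, hu4, hv4⟩ := hthree
    refine red_three hG huv hu4 hv4 fun Y hY1 hY2 => ?_
    by_contra hc
    have hc' : bd G Y ≤ 2 := by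
      have : ¬ 3 ≤ bd G Y := by rw [bd]; convert hc
      omega
    obtain ⟨p, q, r, s, t, w, e1, e2, e3, e4, e5, e6⟩ := regions G S Y
    have m1 := hmin2 (S ∩ Y) Finset.inter_subset_left ⟨u, Finset.mem_inter.mpr ⟨hu, hY1⟩⟩
      (fun h => hY2 (Finset.mem_inter.mp (h ▸ hv)).2)
    have m2 := hmin2 (S \ Y) Finset.sdiff_subset ⟨v, Finset.mem_sdiff.mpr ⟨hv, hY2⟩⟩
      (fun h => (Finset.mem_sdiff.mp (h ▸ hu)).2 hY1)
    have b1 := hB (Y \ S)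
    have b2 := hB (S ∪ Y)ᶜ
    omega
  exfalso
  push Not at hfour hthree
  by_cases hw : ∃ w ∈ S, dg G w = 4
  · obtain ⟨w, hwS, hw4⟩ := hw
    have k1 : ∀ x ∈ S.erase w, 2 ≤ ∑ y ∈ Sᶜ, if G.Adj x y then 1 else 0 := by
      intro x hx
      obtain ⟨hxw, hxS⟩ := Finset.mem_erase.mp hx
      have hx3 : dg G x = 3 := by
        rcases h34 x hxS with h | h
        · exact h
        · exact absurd hw4 (hfour x hxS w hwS hxw h)
      have : (∑ y ∈ S, if G.Adj x y then 1 else 0) ≤ 1 := by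
        rw [← Finset.card_filter]
        refine (Finset.card_le_card (t := {w}) ?_).trans (by simp)
        intro y hy
        obtain ⟨hyS, hxy⟩ := Finset.mem_filter.mp hy
        rw [Finset.mem_singleton]
        by_contra hyw
        rcases h34 y hyS with h | h
        · exact hthree x hxS y hyS hxy hx3 h
        · exact hfour y hyS w hwS hyw h hw4
      have := hrow x
      omega
    have k2 : (∑ y ∈ S, if G.Adj w y then 1 else 0) ≤ (S.erase w).card := by
      rw [← Finset.card_filter]
      refine Finset.card_le_card ?_
      intro y hy
      obtain ⟨hyS, hxy⟩ := Finset.mem_filter.mp hy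
      exact Finset.mem_erase.mpr ⟨hxy.ne', hyS⟩
    have k3 := hrow w
    have k4 := Finset.card_nsmul_le_sum _ _ _ k1
    have k5 : bd G S = (∑ y ∈ Sᶜ, if G.Adj w y then 1 else 0) +
        ∑ x ∈ S.erase w, ∑ y ∈ Sᶜ, if G.Adj x y then 1 else 0 := by
      rw [bd, ed]
      exact (Finset.add_sum_erase S _ hwS).symm
    rw [smul_eq_mul] at k4
    omega
  · have hS2 : bd G S ≤ 2 := by
      rcases hSb with h | h
      · exact h
      · exact absurd h.2 hw
    push Not at hw
    obtain ⟨x, hx⟩ := hSne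
    have h3 : ∀ y ∈ S, dg G y = 3 := fun y hy => (h34 y hy).resolve_right (hw y hy)
    have k1 : (∑ y ∈ S, if G.Adj x y then 1 else 0) = 0 :=
      Finset.sum_eq_zero fun y hy => if_neg fun h => hthree x hx y hy h (h3 x hx) (h3 y hy)
    have k2 := hrow x
    have k3 : (∑ y ∈ Sᶜ, if G.Adj x y then 1 else 0) ≤ bd G S := by
      rw [bd, ed]
      exact Finset.single_le_sum (f := fun x => ∑ y ∈ Sᶜ, if G.Adj x y then 1 else 0)
        (fun _ _ => Nat.zero_le _) hx
    have := h3 x hx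
    omega

lemma Pt.mono {K G : SimpleGraph V} (h : K ≤ G) {s : Set (Sym2 V)} (hs : Pt K s) : Pt G s := by
  rcases hs with hs | ⟨e, he, rfl⟩
  · exact Or.inl (hs.mono h)
  · exact Or.inr ⟨e, edgeSet_mono h he, rfl⟩

lemma Pt.sub {G : SimpleGraph V} {s : Set (Sym2 V)} (hs : Pt G s) : s ⊆ G.edgeSet := by
  rcases hs with ⟨u, w, _, rfl⟩ | ⟨e, he, rfl⟩
  · exact fun e he => w.edges_subset_edgeSet he
  · simpa using he

lemma Pt.nonempty {G : SimpleGraph V} {s : Set (Sym2 V)} (hs : Pt G s) : s.Nonempty := by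
  rcases hs with ⟨u, w, hw, rfl⟩ | ⟨e, he, rfl⟩
  · cases w with
    | nil => exact absurd rfl hw.ne_nil
    | cons h p => exact ⟨_, List.mem_cons_self⟩
  · simp

lemma decomp (n : ℕ) : ∀ G : SimpleGraph V, G.edgeSet.ncard ≤ n → (∀ x, dg G x ≤ 4) →
    ∃ L : List (Set (Sym2 V)), (∀ s ∈ L, Pt G s) ∧ L.Pairwise Disjoint ∧
      (∀ e ∈ G.edgeSet, ∃ s ∈ L, e ∈ s) ∧ L.length + cc G ≤ Fintype.card V := by
  classical
  induction n with
  | zero =>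
    intro G hn _
    have h0 : G.edgeSet = ∅ := (Set.ncard_eq_zero (Set.toFinite _)).mp (by omega)
    refine ⟨[], by simp, by simp, by simp [h0], ?_⟩
    rw [List.length_nil, zero_add, cc, ← Nat.card_eq_fintype_card]
    exact Nat.card_le_card_of_surjective G.connectedComponentMk Quot.mk_surjective
  | succ n ih =>
    intro G hn hG
    by_cases h : ∃ x, 0 < dg G x
    · obtain ⟨L, hL, hP, hD, hc⟩ := red_main hG h
      set G' := G.deleteEdges {e | ∃ s ∈ L, e ∈ s} with hG'
      have hle : G' ≤ G := deleteEdges_le _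
      have hlt : G'.edgeSet.ncard < G.edgeSet.ncard := by
        apply Set.ncard_lt_ncard _ (Set.toFinite _)
        refine ⟨edgeSet_mono hle, fun hs => ?_⟩
        obtain ⟨s, hs'⟩ := List.exists_mem_of_ne_nil L hL
        obtain ⟨e, he⟩ := (hP s hs').nonempty
        have := hs ((hP s hs').sub he)
        rw [hG', edgeSet_deleteEdges] at this
        exact this.2 ⟨s, hs', he⟩
      obtain ⟨L', hP', hD', hC', hl'⟩ := ih G' (by omega) (fun x => (dg_mono hle x).trans (hG x))
      refine ⟨L ++ L', ?_, ?_, ?_, ?_⟩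
      · intro s hs
        rcases List.mem_append.mp hs with hs | hs
        · exact hP s hs
        · exact (hP' s hs).mono hle
      · rw [List.pairwise_append]
        refine ⟨hD, hD', fun a ha b hb => ?_⟩
        rw [Set.disjoint_left]
        intro e h1 h2
        have := (hP' b hb).sub h2
        rw [hG', edgeSet_deleteEdges] at this
        exact this.2 ⟨a, ha, h1⟩
      · intro e he
        by_cases hs : ∃ s ∈ L, e ∈ s
        · obtain ⟨s, h1, h2⟩ := hs
          exact ⟨s, List.mem_append_left _ h1, h2⟩
        · obtain ⟨s, h1, h2⟩ := hC' e (by rw [hG', edgeSet_deleteEdges]; exact ⟨he, hs⟩)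
          exact ⟨s, List.mem_append_right _ h1, h2⟩
      · rw [List.length_append]; omega
    · refine ih G ?_ hG
      have h0 : G.edgeSet = ∅ := by
        rw [Set.eq_empty_iff_forall_notMem]
        intro e he
        induction e with
        | _ x y => exact h ⟨x, dg_pos he⟩
      simp [h0]

end CE

/-- If `G` is a simple graph on `n` vertices with maximum degree at most `4`,
then the edge set of `G` can be partitioned into at most `n - 1` parts, each of which is
either the edge set of a cycle in `G` or a single edge. -/
theorem ce_le_of_maxDegree_le_four
    {V : Type*} [Fintype V] [DecidableEq V] (G : SimpleGraph V) [DecidableRel G.Adj]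
    (hdeg : ∀ v : V, G.degree v ≤ 4) :
    ∃ (k : ℕ) (f : Fin k → Set (Sym2 V)),
      k ≤ Fintype.card V - 1 ∧
      (∀ i, (∃ (u : V) (w : G.Walk u u), w.IsCycle ∧ f i = {e | e ∈ w.edges}) ∨
            (∃ e ∈ G.edgeSet, f i = {e})) ∧
      (∀ i j, i ≠ j → Disjoint (f i) (f j)) ∧
      (∀ e, e ∈ G.edgeSet ↔ ∃ i, e ∈ f i) := by
  obtain ⟨L, hP, hD, hC, hl⟩ := CE.decomp _ G le_rfl (fun x => by rw [CE.dg_eq]; exact hdeg x)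
  refine ⟨L.length, L.get, ?_, fun i => hP _ (L.get_mem i), ?_, ?_⟩
  · rcases isEmpty_or_nonempty V with hV | hV
    · have : Fintype.card V = 0 := Fintype.card_eq_zero
      omega
    · have : 0 < CE.cc G := by
        haveI : Nonempty G.ConnectedComponent := hV.map G.connectedComponentMk
        exact Nat.card_pos
      omega
  · intro i j hij
    rcases lt_or_gt_of_ne hij with h | h
    · exact List.pairwise_iff_get.mp hD i j h
    · exact (List.pairwise_iff_get.mp hD j i h).symm
  · intro e
    constructor
    · intro he
      obtain ⟨s, hs, hes⟩ := hC e he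
      obtain ⟨i, rfl⟩ := List.get_of_mem hs
      exact ⟨i, hes⟩
    · rintro ⟨i, hi⟩
      exact (hP _ (L.get_mem i)).sub hi
end

section
/- If G is a 2k-regular simple graph on n vertices with girth g (i.e., the shortest cycle of G has length g), then the edge set of G can be partitioned into at most kn/g cycles; in particular ce(G) ≤ kn/g. -/
section Helpers
open SimpleGraph

theorem aux_exists_cycle {V : Type*} [Fintype V] [DecidableEq V] (H : SimpleGraph V)
    (heven : ∀ x, Even (H.incidenceSet x).ncard) (hne : H.edgeSet.Nonempty) :
    ∃ (u : V) (w : H.Walk u u), w.IsCycle := by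
  classical
  by_contra hcon
  have hac : H.IsAcyclic := fun u w hw => hcon ⟨u, w, hw⟩
  have hdeg : ∀ x, Even (H.degree x) := by
    intro x
    have h := heven x
    rwa [← coe_incidenceFinset, Set.ncard_coe_finset, card_incidenceFinset_eq_degree] at h
  have key : ∀ n : ℕ, ∃ (u v : V) (p : H.Walk u v), p.IsPath ∧ p.length = n + 1 := by
    intro n
    induction n with
    | zero =>
      obtain ⟨e, he⟩ := hne
      induction e with
      | h a b =>
        have hab : H.Adj a b := he
        exact ⟨a, b, hab.toWalk, by simp [Walk.isPath_def, hab.ne], by simp⟩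
    | succ n ih =>
      obtain ⟨u, v, p, hp, hl⟩ := ih
      have hnn : ¬ p.Nil := by
        intro h
        rw [← Walk.length_eq_zero_iff] at h
        omega
      have hadj : H.Adj p.penultimate v := p.adj_penultimate hnn
      have hmem : p.penultimate ∈ H.neighborFinset v := by simpa using hadj.symm
      have h1 : 1 < (H.neighborFinset v).card := by
        have h0 : 0 < (H.neighborFinset v).card := Finset.card_pos.2 ⟨_, hmem⟩
        have h2 := hdeg v
        rw [← card_neighborFinset_eq_degree] at h2
        obtain ⟨r, hr⟩ := h2
        omega
      obtain ⟨w, hw, hne'⟩ := Finset.exists_mem_ne h1 p.penultimate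
      have hvw : H.Adj v w := by simpa using hw
      have hns : w ∉ p.support := fun hs =>
        hne' (hac.eq_penultimate_of_adj_end hp hvw hs)
      exact ⟨u, w, p.concat hvw, hp.concat hns hvw, by simp [hl]⟩
  obtain ⟨u, v, p, hp, hl⟩ := key (Fintype.card V)
  have := hp.length_lt
  omega

theorem aux_decomp {V : Type*} [Fintype V] [DecidableEq V] (g : ℕ) (N : ℕ) :
    ∀ (H : SimpleGraph V), H.edgeSet.ncard = N →
    (∀ x, Even (H.incidenceSet x).ncard) →
    (∀ (u : V) (w : H.Walk u u), w.IsCycle → g ≤ w.length) →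
    ∃ (m : ℕ) (f : Fin m → Set (Sym2 V)),
      m * g ≤ N ∧
      (∀ i, ∃ (u : V) (w : H.Walk u u), w.IsCycle ∧ f i = {e | e ∈ w.edges}) ∧
      (∀ i j, i ≠ j → Disjoint (f i) (f j)) ∧
      (∀ e, e ∈ H.edgeSet ↔ ∃ i, e ∈ f i) := by
  classical
  induction N using Nat.strong_induction_on with
  | _ N ih =>
  intro H hN heven hg
  rcases Set.eq_empty_or_nonempty H.edgeSet with hemp | hne
  · exact ⟨0, fun i => i.elim0, by simp, fun i => i.elim0, fun i => i.elim0, by simp [hemp]⟩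
  obtain ⟨u, w, hw⟩ := aux_exists_cycle H heven hne
  set C : Set (Sym2 V) := {e | e ∈ w.edges} with hC
  have hCeq : C = (w.edges.toFinset : Set (Sym2 V)) := by ext; simp [hC]
  have hCsub : C ⊆ H.edgeSet := fun e he => w.edges_subset_edgeSet he
  have hCcard : C.ncard = w.length := by
    rw [hCeq, Set.ncard_coe_finset, List.toFinset_card_of_nodup hw.isTrail.edges_nodup,
      Walk.length_edges]
  have h3 := hw.three_le_length
  set K := H.deleteEdges C with hK
  have hKH : K ≤ H := deleteEdges_le C
  have hKe : K.edgeSet = H.edgeSet \ C := edgeSet_deleteEdges C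
  have hKcard : K.edgeSet.ncard + w.length = N := by
    rw [hKe, ← hCcard, Set.ncard_sdiff_add_ncard_of_subset hCsub, hN]
  have hKeven : ∀ x, Even (K.incidenceSet x).ncard := by
    intro x
    have hsub : {e | e ∈ C ∧ x ∈ e} ⊆ H.incidenceSet x := fun e he => ⟨hCsub he.1, he.2⟩
    have heq : K.incidenceSet x = H.incidenceSet x \ {e | e ∈ C ∧ x ∈ e} := by
      ext e
      simp only [incidenceSet, hKe, Set.mem_sdiff, Set.mem_ofPred_eq]
      tauto
    have hc : Even ({e | e ∈ C ∧ x ∈ e} : Set (Sym2 V)).ncard := by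
      have h := (hw.isTrail.even_countP_edges_iff x).2 (fun h => absurd rfl h)
      have h' : ({e | e ∈ C ∧ x ∈ e} : Set (Sym2 V)) =
          ((w.edges.filter (fun e => x ∈ e)).toFinset : Set (Sym2 V)) := by
        ext; simp [hC]
      rw [h', Set.ncard_coe_finset,
        List.toFinset_card_of_nodup (hw.isTrail.edges_nodup.filter _),
        ← List.countP_eq_length_filter]
      exact h
    have hs := Set.ncard_sdiff_add_ncard_of_subset hsub
    rw [← heq] at hs
    have hx := heven x
    rw [← hs, Nat.even_add] at hx
    exact hx.2 hc
  have hKg : ∀ (u : V) (w : K.Walk u u), w.IsCycle → g ≤ w.length := by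
    intro u w hw
    have := hg u (w.mapLe hKH) (hw.mapLe hKH)
    simpa using this
  obtain ⟨m, f, hm, hcyc, hdis, hcov⟩ := ih _ (by omega) K rfl hKeven hKg
  have hfK : ∀ i, f i ⊆ H.edgeSet \ C := by
    intro i e he
    rw [← hKe]
    exact (hcov e).2 ⟨i, he⟩
  have hdC : ∀ i, Disjoint C (f i) := fun i =>
    Set.disjoint_left.2 fun e he he' => (hfK i he').2 he
  refine ⟨m + 1, Fin.cons C f, ?_, ?_, ?_, ?_⟩
  · have := hg u w hw
    rw [Nat.add_mul]
    omega
  · intro i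
    refine Fin.cases ?_ (fun i => ?_) i
    · exact ⟨u, w, hw, by simp [hC]⟩
    · obtain ⟨u', w', hw', he⟩ := hcyc i
      exact ⟨u', w'.mapLe hKH, hw'.mapLe hKH, by simp [he]⟩
  · intro i j
    refine Fin.cases ?_ (fun i => ?_) i <;> refine Fin.cases ?_ (fun j => ?_) j
    · intro h; exact absurd rfl h
    · intro _; simpa using hdC j
    · intro _; simpa using (hdC i).symm
    · intro h
      simpa using hdis i j (fun h' => h (by rw [h']))
  · intro e
    rw [Fin.exists_fin_succ]
    simp only [Fin.cons_zero, Fin.cons_succ, ← hcov e, hKe, Set.mem_sdiff]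
    constructor
    · intro h; tauto
    · rintro (h | h)
      · exact hCsub h
      · exact h.1

end Helpers

/-- If `G` is a `2k`-regular simple graph on `n` vertices with girth `g`
(i.e. `G` has a cycle of length `g` and every cycle of `G` has length at least `g`),
then the edge set of `G` can be partitioned into `m` cycles where `m ≤ kn/g`
(expressed as `m * g ≤ k * n`). -/
theorem cycle_decomposition_of_regular_girth
    {V : Type*} [Fintype V] [DecidableEq V] (G : SimpleGraph V) [DecidableRel G.Adj]
    (k g : ℕ) (hreg : G.IsRegularOfDegree (2 * k))
    (hgirth_ex : ∃ (u : V) (w : G.Walk u u), w.IsCycle ∧ w.length = g)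
    (hgirth_min : ∀ (u : V) (w : G.Walk u u), w.IsCycle → g ≤ w.length) :
    ∃ (m : ℕ) (f : Fin m → Set (Sym2 V)),
      m * g ≤ k * Fintype.card V ∧
      (∀ i, ∃ (u : V) (w : G.Walk u u), w.IsCycle ∧ f i = {e | e ∈ w.edges}) ∧
      (∀ i j, i ≠ j → Disjoint (f i) (f j)) ∧
      (∀ e, e ∈ G.edgeSet ↔ ∃ i, e ∈ f i) := by
  classical
  have heven : ∀ x, Even (G.incidenceSet x).ncard := by
    intro x
    rw [← SimpleGraph.coe_incidenceFinset, Set.ncard_coe_finset,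
      SimpleGraph.card_incidenceFinset_eq_degree, hreg x]
    exact even_two_mul k
  have hcard : G.edgeSet.ncard = k * Fintype.card V := by
    have h := G.sum_degrees_eq_twice_card_edges
    rw [Finset.sum_congr rfl (fun v _ => hreg v), Finset.sum_const, Finset.card_univ,
      smul_eq_mul] at h
    rw [← SimpleGraph.coe_edgeFinset, Set.ncard_coe_finset]
    have h2 : 2 * (k * Fintype.card V) = Fintype.card V * (2 * k) := by ring
    omega
  exact aux_decomp g _ G hcard heven hgirth_min
end

section
/- Every simple graph G on n vertices that contains at least one cycle admits a partition of its edge set into the edge set of an even subgraph together with at most n-2 further parts, each consisting of a single edge. -/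
lemma aux_even_symmDiff {α : Type*} [Finite α] (s t : Set α) (hs : Even s.ncard)
    (ht : Even t.ncard) : Even (symmDiff s t).ncard := by
  have h1 := Set.ncard_inter_add_ncard_diff_eq_ncard s t (Set.toFinite _)
  have h2 := Set.ncard_inter_add_ncard_diff_eq_ncard t s (Set.toFinite _)
  have h3 : (symmDiff s t).ncard = (s \ t).ncard + (t \ s).ncard := by
    rw [Set.symmDiff_def]
    exact Set.ncard_union_eq (by
      rw [Set.disjoint_left]; rintro x ⟨_, h⟩ ⟨h', _⟩; exact h h')
  rw [Set.inter_comm] at h2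
  grind

lemma aux_card {α : Type*} [Finite α] (E h c : Set α) (hc : c ⊆ E)
    (h3 : 3 ≤ c.ncard) (h1 : (c ∩ h).ncard ≤ 1) :
    (E \ symmDiff h c).ncard < (E \ h).ncard := by
  have e1 : E \ symmDiff h c ⊆ ((E \ h) \ c) ∪ (c ∩ h) := by
    intro x
    simp only [Set.mem_diff, Set.mem_symmDiff, Set.mem_union, Set.mem_inter_iff]
    tauto
  have e2 := Set.ncard_le_ncard e1 (Set.toFinite _)
  have e3 := Set.ncard_union_le ((E \ h) \ c) (c ∩ h)
  have e4 := Set.ncard_inter_add_ncard_diff_eq_ncard c h (Set.toFinite _)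
  have e5 := Set.ncard_inter_add_ncard_diff_eq_ncard (E \ h) c (Set.toFinite _)
  have e6 : (E \ h) ∩ c = c \ h := by
    ext x
    have := @hc x
    simp only [Set.mem_diff, Set.mem_inter_iff]
    tauto
  rw [e6] at e5
  omega

lemma aux_step {V : Type*} [Fintype V] [DecidableEq V] (G H : SimpleGraph V)
    (hH : H ≤ G) (hev : ∀ v : V, Even ((H.neighborSet v).ncard))
    {u : V} (w : G.Walk u u) (hw : w.IsCycle)
    (h1 : ({e | e ∈ w.edges} ∩ H.edgeSet).ncard ≤ 1) :
    ∃ H' : SimpleGraph V, H' ≤ G ∧ (∀ v : V, Even ((H'.neighborSet v).ncard)) ∧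
      (G.edgeSet \ H'.edgeSet).ncard < (G.edgeSet \ H.edgeSet).ncard := by
  set C : SimpleGraph V := w.toSubgraph.spanningCoe with hC
  have hCG : C ≤ G := w.toSubgraph.spanningCoe_le
  have hCe : C.edgeSet = {e | e ∈ w.edges} := by
    ext e
    rw [hC, SimpleGraph.Subgraph.edgeSet_spanningCoe, SimpleGraph.Walk.mem_edges_toSubgraph]
    rfl
  refine ⟨symmDiff H C, ?_, ?_, ?_⟩
  · exact symmDiff_le_sup.trans (sup_le hH hCG)
  · intro v
    have : (symmDiff H C).neighborSet v = symmDiff (H.neighborSet v) (C.neighborSet v) := by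
      ext x
      simp [symmDiff_def, Set.mem_symmDiff]
    rw [this]
    refine aux_even_symmDiff _ _ (hev v) ?_
    have hn : C.neighborSet v = w.toSubgraph.neighborSet v := by
      ext x; simp [hC]
    rw [hn]
    by_cases hv : v ∈ w.support
    · rw [hw.ncard_neighborSet_toSubgraph_eq_two hv]; exact even_two
    · have : w.toSubgraph.neighborSet v = ∅ := by
        ext x
        simp only [SimpleGraph.Subgraph.mem_neighborSet, Set.mem_empty_iff_false, iff_false]
        intro h
        exact hv (w.mem_verts_toSubgraph.mp h.fst_mem)
      rw [this]; simp
  · have : (symmDiff H C).edgeSet = symmDiff H.edgeSet C.edgeSet := by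
      simp [symmDiff_def]
    rw [this]
    refine aux_card _ _ _ (SimpleGraph.edgeSet_mono hCG) ?_ (hCe ▸ h1)
    have h3 := hw.three_le_length
    have : C.edgeSet = (w.edges.toFinset : Set (Sym2 V)) := by
      rw [hCe]; ext e; simp
    rw [this, Set.ncard_coe_finset, List.toFinset_card_of_nodup hw.edges_nodup,
      SimpleGraph.Walk.length_edges]
    exact h3

lemma aux_tree {V : Type*} [Fintype V] [DecidableEq V] [Nonempty V] (F : SimpleGraph V)
    (hF : F.IsAcyclic) (hc : Fintype.card V ≤ F.edgeSet.ncard + 1) : F.IsTree := by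
  obtain ⟨T, hFT, hT⟩ := Finite.exists_le_maximal (p := SimpleGraph.IsAcyclic) hF
  have hTt := SimpleGraph.isTree_iff_maximal_isAcyclic.mpr ⟨inferInstance, hT⟩
  have hcard := (SimpleGraph.isTree_iff_connected_and_card.mp hTt).2
  rw [Nat.card_coe_set_eq, Nat.card_eq_fintype_card] at hcard
  have := Set.eq_of_subset_of_ncard_le (SimpleGraph.edgeSet_mono hFT) (by omega) (Set.toFinite _)
  rw [SimpleGraph.edgeSet_inj.mp this]
  exact hTt

/-- Every simple graph `G` on `n` vertices containing a cycle admits a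
partition of its edge set into the edge set of an even subgraph together with at most
`n - 2` further parts, each consisting of a single edge.  (Equivalently: there is an
even subgraph `H ≤ G` such that at most `n - 2` edges of `G` lie outside `H`.) -/
theorem even_subgraph_plus_edges_decomposition
    {V : Type*} [Fintype V] [DecidableEq V] (G : SimpleGraph V)
    (hcyc : ∃ (u : V) (w : G.Walk u u), w.IsCycle) :
    ∃ H : SimpleGraph V, H ≤ G ∧
      (∀ v : V, Even ((H.neighborSet v).ncard)) ∧
      (G.edgeSet \ H.edgeSet).ncard ≤ Fintype.card V - 2 := by
  obtain ⟨u₀, w₀, hw₀⟩ := hcyc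
  have : Nonempty V := ⟨u₀⟩
  have hne : ∃ n : ℕ, ∃ H : SimpleGraph V, H ≤ G ∧
      (∀ v : V, Even ((H.neighborSet v).ncard)) ∧ (G.edgeSet \ H.edgeSet).ncard = n :=
    ⟨_, ⊥, bot_le, by simp, rfl⟩
  classical
  obtain ⟨H, hH, hev, hn⟩ := Nat.find_spec hne
  have hmin : ∀ {u : V} (w : G.Walk u u), w.IsCycle →
      ¬ ({e | e ∈ w.edges} ∩ H.edgeSet).ncard ≤ 1 := by
    intro u w hw h1
    obtain ⟨H', a, b, c⟩ := aux_step G H hH hev w hw h1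
    rw [hn] at c
    exact Nat.find_min hne c ⟨H', a, b, rfl⟩
  refine ⟨H, hH, hev, ?_⟩
  by_contra hlt
  have hle : G \ H ≤ G := sdiff_le
  have hdis : ∀ {u v : V} (p : (G \ H).Walk u v) (e), e ∈ p.edges → e ∉ H.edgeSet := by
    intro u v p e he
    have := p.edges_subset_edgeSet he
    rw [SimpleGraph.edgeSet_sdiff] at this
    exact this.2
  have hac : (G \ H).IsAcyclic := by
    intro u w hw
    apply hmin (w.mapLe hle) (hw.mapLe hle)
    have : {e | e ∈ (w.mapLe hle).edges} ∩ H.edgeSet = ∅ := by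
      ext e
      simp only [SimpleGraph.Walk.edges_mapLe_eq_edges, Set.mem_inter_iff, Set.mem_setOf_eq,
        Set.mem_empty_iff_false, iff_false, not_and]
      exact hdis w e
    rw [this]; simp
  have htree : (G \ H).IsTree := by
    apply aux_tree _ hac
    rw [SimpleGraph.edgeSet_sdiff]
    omega
  by_cases hb : H = ⊥
  · subst hb
    rw [sdiff_bot] at hac
    exact hac w₀ hw₀
  · obtain ⟨a, b, hab⟩ := SimpleGraph.ne_bot_iff_exists_adj.mp hb
    obtain ⟨p, hp⟩ := (htree.connected b a).exists_isPath
    have hcy : (SimpleGraph.Walk.cons (hH hab) (p.mapLe hle)).IsCycle := by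
      rw [SimpleGraph.Walk.cons_isCycle_iff]
      refine ⟨hp.mapLe hle, ?_⟩
      rw [SimpleGraph.Walk.edges_mapLe_eq_edges]
      intro h
      exact hdis p _ h hab
    apply hmin _ hcy
    have : {e | e ∈ (SimpleGraph.Walk.cons (hH hab) (p.mapLe hle)).edges} ∩ H.edgeSet
        ⊆ {s(a, b)} := by
      rintro e ⟨h1, h2⟩
      simp only [SimpleGraph.Walk.edges_cons, SimpleGraph.Walk.edges_mapLe_eq_edges,
        Set.mem_setOf_eq, List.mem_cons] at h1
      rcases h1 with h1 | h1
      · exact h1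
      · exact absurd h2 (hdis p e h1)
    simpa using Set.ncard_le_ncard this (Set.toFinite _)
end

section
/- Let G be a connected simple graph on n vertices that contains a cycle. Then exactly one of the following holds: (i) the edge set of G can be partitioned into the edge set of an even subgraph together with at most n-3 single edges; or (ii) G consists of a complete graph K4 on some 4-element vertex set S together with four vertex-disjoint trees, one attached at each vertex of S; equivalently, the edges of G joining two vertices of S form a K4 on S, and deleting these six edges from G leaves a forest with exactly four components, each containing exactly one vertex of S. -/
/-- `G` decomposes into an even subgraph and at most `m` single edges. -/
def DecomposesIntoEvenAndEdges {V : Type*} (G : SimpleGraph V) (m : ℕ) : Prop :=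
  ∃ H : SimpleGraph V, H ≤ G ∧
    (∀ v : V, Even ((H.neighborSet v).ncard)) ∧
    (G.edgeSet \ H.edgeSet).ncard ≤ m

/-- `G` is a `K₄` on a four-element vertex set `S` together with four vertex-disjoint
trees, one attached at each vertex of `S`: the vertices of `S` are pairwise adjacent,
and deleting the six edges inside `S` leaves a forest in which every connected component
contains exactly one vertex of `S` (hence there are exactly four components). -/
def IsK4WithHangingTrees {V : Type*} (G : SimpleGraph V) : Prop :=
  ∃ S : Finset V, S.card = 4 ∧
    (∀ u ∈ S, ∀ v ∈ S, u ≠ v → G.Adj u v) ∧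
    (G.deleteEdges {e : Sym2 V | ∀ x ∈ e, x ∈ S}).IsAcyclic ∧
    (∀ c : (G.deleteEdges {e : Sym2 V | ∀ x ∈ e, x ∈ S}).ConnectedComponent,
      ∃! u : V, u ∈ S ∧
        (G.deleteEdges {e : Sym2 V | ∀ x ∈ e, x ∈ S}).connectedComponentMk u = c)


namespace EvenDec
open SimpleGraph
variable {V : Type*}

def oddAt (J : SimpleGraph V) (x : V) : Prop := Odd (J.neighborSet x).ncard

lemma odd_ncard_symmDiff [Finite V] (A B : Set V) :
    Odd (symmDiff A B).ncard ↔ ¬ (Odd A.ncard ↔ Odd B.ncard) := by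
  have h1 := Set.ncard_inter_add_ncard_sdiff_eq_ncard A B (Set.toFinite _)
  have h2 := Set.ncard_inter_add_ncard_sdiff_eq_ncard B A (Set.toFinite _)
  have h3 : (symmDiff A B).ncard = (A \ B).ncard + (B \ A).ncard := by
    rw [Set.symmDiff_def]
    exact Set.ncard_union_eq (by
      rw [Set.disjoint_left]; rintro x ⟨_, h⟩ ⟨h', _⟩; exact h h') (Set.toFinite _) (Set.toFinite _)
  rw [Set.inter_comm] at h2
  rw [h3, ← h1, ← h2]
  grind

lemma adj_symmDiff (J K : SimpleGraph V) (x y : V) :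
    (symmDiff J K).Adj x y ↔ ¬ (J.Adj x y ↔ K.Adj x y) := by
  simp only [symmDiff, SimpleGraph.sup_adj, SimpleGraph.sdiff_adj]
  tauto

lemma oddAt_symmDiff [Finite V] (J K : SimpleGraph V) (x : V) :
    oddAt (symmDiff J K) x ↔ ¬ (oddAt J x ↔ oddAt K x) := by
  unfold oddAt
  rw [← odd_ncard_symmDiff]
  have : (symmDiff J K).neighborSet x = symmDiff (J.neighborSet x) (K.neighborSet x) := by
    ext y
    simp only [SimpleGraph.mem_neighborSet, adj_symmDiff, Set.mem_symmDiff]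
    tauto
  rw [this]

lemma oddAt_edge {u v : V} (h : u ≠ v) (x : V) : oddAt (edge u v) x ↔ (x = u ∨ x = v) := by
  unfold oddAt
  by_cases h1 : x = u
  · have : (edge u v).neighborSet x = {v} := by
      ext y; subst h1; simp [edge_adj]; grind
    rw [this]; simp [h1]
  · by_cases h2 : x = v
    · have : (edge u v).neighborSet x = {u} := by
        ext y; subst h2; simp [edge_adj]; grind
      rw [this]; simp [h2]
    · have : (edge u v).neighborSet x = ∅ := by
        ext y; simp [edge_adj]; grind
      simp [this, h1, h2]

lemma oddAt.exists_adj {J : SimpleGraph V} {x : V} (h : oddAt J x) : ∃ y, J.Adj x y := by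
  have : (J.neighborSet x).Nonempty := by
    by_contra hc
    rw [Set.not_nonempty_iff_eq_empty] at hc
    simp [oddAt, hc] at h
  exact this

lemma exists_join_aux [Finite V] {F : SimpleGraph V} {u v : V} (w : F.Walk u v) :
    ∃ J ≤ F, ∀ x, oddAt J x ↔ ¬ (x = u ↔ x = v) := by
  induction w with
  | nil => exact ⟨⊥, bot_le, fun x => by simp [oddAt]⟩
  | @cons a b c h p ih =>
    obtain ⟨J, hJ, hp⟩ := ih
    refine ⟨symmDiff J (edge a b), ?_, fun x => ?_⟩
    · intro x y hxy
      rw [adj_symmDiff] at hxy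
      by_cases hj : J.Adj x y
      · exact hJ hj
      · have : (edge a b).Adj x y := by tauto
        rw [edge_adj] at this
        rcases this with ⟨⟨rfl, rfl⟩ | ⟨rfl, rfl⟩, _⟩
        exacts [h, h.symm]
    · rw [oddAt_symmDiff, oddAt_edge h.ne, hp]
      have := h.ne
      grind

lemma exists_join [Finite V] {F : SimpleGraph V} {u v : V} (h : F.Reachable u v) (huv : u ≠ v) :
    ∃ J ≤ F, ∀ x, oddAt J x ↔ (x = u ∨ x = v) := by
  obtain ⟨w⟩ := h
  obtain ⟨J, hJ, hp⟩ := exists_join_aux w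
  exact ⟨J, hJ, fun x => by rw [hp]; grind⟩

/-- `H` is an even subgraph of `G` with the maximum number of edges. -/
structure MaxEven (G H : SimpleGraph V) : Prop where
  le : H ≤ G
  even : ∀ x, ¬ oddAt H x
  max : ∀ K ≤ G, (∀ x, ¬ oddAt K x) → K.edgeSet.ncard ≤ H.edgeSet.ncard

lemma exists_maxEven [Finite V] (G : SimpleGraph V) : ∃ H, MaxEven G H := by
  have hfin : {K : SimpleGraph V | K ≤ G ∧ ∀ x, ¬ oddAt K x}.Finite := Set.toFinite _
  obtain ⟨H, hH, hm⟩ := Set.exists_max_image _ (fun K : SimpleGraph V => K.edgeSet.ncard) hfin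
    ⟨⊥, bot_le, fun x => by simp [oddAt]⟩
  exact ⟨H, hH.1, hH.2, fun K h1 h2 => hm K ⟨h1, h2⟩⟩

lemma MaxEven.exch [Finite V] {G H : SimpleGraph V} (h : MaxEven G H) (C : SimpleGraph V)
    (hC : C ≤ G) (he : ∀ x, ¬ oddAt C x) :
    (C.edgeSet \ H.edgeSet).ncard ≤ (H.edgeSet ∩ C.edgeSet).ncard := by
  have h1 := h.max (symmDiff H C) (by
    intro x y hxy
    rw [adj_symmDiff] at hxy
    have := @h.le x y
    have := @hC x y
    tauto) (fun x => by
      rw [oddAt_symmDiff]; have := h.even x; have := he x; tauto)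
  have h2 : (symmDiff H C).edgeSet = (H.edgeSet \ C.edgeSet) ∪ (C.edgeSet \ H.edgeSet) := by
    simp [symmDiff]
  rw [h2, Set.ncard_union_eq (by
      rw [Set.disjoint_left]; rintro x ⟨_, h⟩ ⟨h', _⟩; exact h h')
      (Set.toFinite _) (Set.toFinite _)] at h1
  have h3 := Set.ncard_inter_add_ncard_sdiff_eq_ncard H.edgeSet C.edgeSet (Set.toFinite _)
  omega

lemma MaxEven.acyclic [Finite V] {G H : SimpleGraph V} (h : MaxEven G H) : (G \ H).IsAcyclic := by
  rw [isAcyclic_iff_forall_adj_isBridge]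
  intro u v huv
  rw [isBridge_iff]
  intro hr
  obtain ⟨J, hJ, hodd⟩ := exists_join hr huv.ne
  have hJ' : ∀ x y, J.Adj x y → (G \ H).Adj x y ∧ s(x, y) ≠ s(u, v) := by
    intro x y hxy
    have := hJ hxy
    simpa [deleteEdges_adj] using this
  have hCF : ∀ x y, (symmDiff J (edge u v)).Adj x y → (G \ H).Adj x y := by
    intro x y hxy
    rw [adj_symmDiff] at hxy
    by_cases hj : J.Adj x y
    · exact (hJ' _ _ hj).1
    · have : (edge u v).Adj x y := by tauto
      rw [edge_adj] at this
      rcases this with ⟨⟨rfl, rfl⟩ | ⟨rfl, rfl⟩, _⟩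
      exacts [huv, huv.symm]
  have key := h.exch (symmDiff J (edge u v)) (fun x y hxy => (hCF x y hxy).1) (fun x => by
    rw [oddAt_symmDiff, oddAt_edge huv.ne, hodd]; tauto)
  have e1 : H.edgeSet ∩ (symmDiff J (edge u v)).edgeSet = ∅ := by
    ext e
    induction e with | h x y =>
    simp only [Set.mem_inter_iff, mem_edgeSet, Set.mem_empty_iff_false, iff_false]
    rintro ⟨h1, h2⟩
    exact (hCF x y h2).2 h1
  rw [e1, Set.ncard_empty, Nat.le_zero, Set.ncard_eq_zero (Set.toFinite _)] at key
  have : s(u, v) ∈ (symmDiff J (edge u v)).edgeSet \ H.edgeSet := by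
    refine ⟨?_, huv.2⟩
    rw [mem_edgeSet, adj_symmDiff]
    have h1 : (edge u v).Adj u v := by rw [edge_adj]; exact ⟨Or.inl ⟨rfl, rfl⟩, huv.ne⟩
    have h2 : ¬ J.Adj u v := fun hj => (hJ' _ _ hj).2 rfl
    tauto
  rw [key] at this
  exact this

lemma MaxEven.not_reachable [Finite V] {G H : SimpleGraph V} (h : MaxEven G H) {u v : V}
    (huv : H.Adj u v) : ¬ (G \ H).Reachable u v := by
  intro hr
  obtain ⟨J, hJ, hodd⟩ := exists_join hr huv.ne
  have key := h.exch (symmDiff J (edge u v)) (by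
    intro x y hxy
    rw [adj_symmDiff] at hxy
    by_cases hj : J.Adj x y
    · exact (hJ hj).1
    · have : (edge u v).Adj x y := by tauto
      rw [edge_adj] at this
      rcases this with ⟨⟨rfl, rfl⟩ | ⟨rfl, rfl⟩, _⟩
      exacts [h.le huv, h.le huv.symm]) (fun x => by
    rw [oddAt_symmDiff, oddAt_edge huv.ne, hodd]; tauto)
  have e1 : H.edgeSet ∩ (symmDiff J (edge u v)).edgeSet ⊆ {s(u, v)} := by
    intro e
    induction e with | h x y =>
    simp only [Set.mem_inter_iff, mem_edgeSet, Set.mem_singleton_iff]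
    rintro ⟨h1, h2⟩
    rw [adj_symmDiff] at h2
    have h3 : ¬ J.Adj x y := fun hj => (hJ hj).2 h1
    have : (edge u v).Adj x y := by tauto
    rw [edge_adj] at this
    grind
  have h1 := Set.ncard_le_ncard e1
  rw [Set.ncard_singleton] at h1
  obtain ⟨p, hp⟩ := ((hodd u).2 (Or.inl rfl)).exists_adj
  obtain ⟨q, hq⟩ := ((hodd v).2 (Or.inr rfl)).exists_adj
  have hne := huv.ne
  have hpv : p ≠ v := by rintro rfl; exact (hJ hp).2 huv
  have hqu : q ≠ u := by rintro rfl; exact (hJ hq).2 huv.symm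
  have e2 : {s(u, p), s(v, q)} ⊆ (symmDiff J (edge u v)).edgeSet \ H.edgeSet := by
    intro e he
    simp only [Set.mem_insert_iff, Set.mem_singleton_iff] at he
    rcases he with rfl | rfl
    · refine ⟨?_, (hJ hp).2⟩
      rw [mem_edgeSet, adj_symmDiff, edge_adj]; grind
    · refine ⟨?_, (hJ hq).2⟩
      rw [mem_edgeSet, adj_symmDiff, edge_adj]; grind
  have h2 := Set.ncard_le_ncard e2
  rw [Set.ncard_pair (by simp; grind)] at h2
  omega

lemma MaxEven.adj_of_two [Finite V] {G H : SimpleGraph V} (h : MaxEven G H) {x y x' y' : V}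
    (hxy : H.Adj x y) (hxy' : H.Adj x' y') (hx : x ≠ x') (hy : y ≠ y')
    (hrx : (G \ H).Reachable x x') (hry : (G \ H).Reachable y y') : (G \ H).Adj x x' := by
  by_contra hcon
  obtain ⟨J1, hJ1, hodd1⟩ := exists_join hrx hx
  obtain ⟨J2, hJ2, hodd2⟩ := exists_join hry hy
  have n1 := h.not_reachable hxy
  have n2 := h.not_reachable hxy'
  have n3 : ¬ (G \ H).Reachable x' y := fun hh => n1 (hrx.trans hh)
  have n4 : ¬ (G \ H).Reachable x y' := fun hh => n2 (hrx.symm.trans hh)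
  have d3 : x' ≠ y := by rintro rfl; exact n3 (Reachable.refl _)
  have d4 : x ≠ y' := by rintro rfl; exact n4 (Reachable.refl _)
  have d1 := hxy.ne
  have d2 := hxy'.ne
  obtain ⟨J, hJdef⟩ : ∃ J, J = symmDiff J1 J2 := ⟨_, rfl⟩
  obtain ⟨D, hDdef⟩ : ∃ D, D = symmDiff (edge x y) (edge x' y') := ⟨_, rfl⟩
  have hJ : ∀ a b, J.Adj a b → (G \ H).Adj a b := by
    intro a b hab
    rw [hJdef, adj_symmDiff] at hab
    have := @hJ1 a b
    have := @hJ2 a b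
    tauto
  have hoJ : ∀ z, oddAt J z ↔ (z = x ∨ z = x' ∨ z = y ∨ z = y') := by
    intro z
    rw [hJdef, oddAt_symmDiff, hodd1, hodd2]; grind
  have hoD : ∀ z, oddAt D z ↔ (z = x ∨ z = x' ∨ z = y ∨ z = y') := by
    intro z
    rw [hDdef, oddAt_symmDiff, oddAt_edge d1, oddAt_edge d2]; grind
  have hD : ∀ a b, D.Adj a b → H.Adj a b ∧ (s(a, b) = s(x, y) ∨ s(a, b) = s(x', y')) := by
    intro a b hab
    rw [hDdef, adj_symmDiff, edge_adj, edge_adj] at hab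
    have := hxy.symm
    have := hxy'.symm
    grind
  have key := h.exch (symmDiff J D) (by
    intro a b hab
    rw [adj_symmDiff] at hab
    by_cases hj : J.Adj a b
    · exact (hJ _ _ hj).1
    · exact h.le (hD a b (by tauto)).1) (fun z => by
    rw [oddAt_symmDiff, hoJ, hoD]; tauto)
  have e1 : H.edgeSet ∩ (symmDiff J D).edgeSet ⊆ {s(x, y), s(x', y')} := by
    intro e
    induction e with | h a b =>
    simp only [Set.mem_inter_iff, mem_edgeSet, Set.mem_insert_iff, Set.mem_singleton_iff]
    rintro ⟨h1, h2⟩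
    rw [adj_symmDiff] at h2
    have h3 : ¬ J.Adj a b := fun hj => (hJ _ _ hj).2 h1
    exact (hD a b (by tauto)).2
  have h1 := (Set.ncard_le_ncard e1).trans (Set.ncard_insert_le _ _)
  rw [Set.ncard_singleton] at h1
  obtain ⟨p, hp⟩ := ((hoJ x).2 (by simp)).exists_adj
  obtain ⟨q, hq⟩ := ((hoJ x').2 (by simp)).exists_adj
  obtain ⟨r, hr⟩ := ((hoJ y).2 (by simp)).exists_adj
  have hpx : p ≠ x' := by rintro rfl; exact hcon (hJ _ _ hp)
  have hpy : p ≠ y := by rintro rfl; exact n1 (hJ _ _ hp).reachable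
  have hqy : q ≠ y := by rintro rfl; exact n3 (hJ _ _ hq).reachable
  have e2 : {s(x, p), s(x', q), s(y, r)} ⊆ (symmDiff J D).edgeSet \ H.edgeSet := by
    have gen : ∀ a b, J.Adj a b → s(a, b) ∈ (symmDiff J D).edgeSet \ H.edgeSet := by
      intro a b hab
      have hn := (hJ a b hab).2
      refine ⟨?_, hn⟩
      rw [mem_edgeSet, adj_symmDiff]
      have : ¬ D.Adj a b := fun hd => hn (hD a b hd).1
      tauto
    intro e he
    simp only [Set.mem_insert_iff, Set.mem_singleton_iff] at he
    rcases he with rfl | rfl | rfl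
    exacts [gen _ _ hp, gen _ _ hq, gen _ _ hr]
  have h2 := Set.ncard_le_ncard e2
  rw [Set.ncard_insert_of_notMem (by simp; grind), Set.ncard_pair (by simp; grind)] at h2
  omega

lemma exists_other {H : SimpleGraph V} {x y : V} (he : ¬ oddAt H x)
    (hxy : H.Adj x y) : ∃ z, H.Adj x z ∧ z ≠ y := by
  by_contra! hc
  apply he
  have : H.neighborSet x = {y} := by
    ext z; simp; constructor
    · exact hc z
    · rintro rfl; exact hxy
  simp [oddAt, this]



lemma two_classes [Fintype V] {G F : SimpleGraph V} (hG : G.Connected) (hF : F ≤ G)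
    (hac : F.IsAcyclic) (hcard : Fintype.card V ≤ F.edgeSet.ncard + 2) :
    ∃ a b, ∀ x, F.Reachable a x ∨ F.Reachable b x := by
  obtain ⟨T, hFT, -, hT⟩ := hG.exists_isTree_le_of_le_of_isAcyclic hF hac
  have hTc := (isTree_iff_connected_and_card.1 hT).2
  rw [Nat.card_eq_fintype_card (α := V), Nat.card_coe_set_eq] at hTc
  have hsub : F.edgeSet ⊆ T.edgeSet := edgeSet_subset_edgeSet.2 hFT
  have h1 := Set.ncard_sdiff_add_ncard_of_subset hsub (Set.toFinite _)
  have h2 : (T.edgeSet \ F.edgeSet).ncard ≤ 1 := by omega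
  rw [Set.ncard_le_one (Set.toFinite _)] at h2
  obtain ⟨v⟩ := hT.connected.nonempty
  by_cases hne : ∃ a b, T.Adj a b ∧ ¬ F.Adj a b
  · obtain ⟨a, b, hab, hnab⟩ := hne
    refine ⟨a, b, fun x => ?_⟩
    obtain ⟨w⟩ := hT.connected.preconnected x a
    induction w with
    | nil => exact Or.inl (Reachable.refl _)
    | @cons p q r h w ih =>
      by_cases hpq : F.Adj p q
      · rcases ih hab hnab with h3 | h3
        · exact Or.inl (h3.trans hpq.symm.reachable)
        · exact Or.inr (h3.trans hpq.symm.reachable)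
      · have := h2 s(p, q) ⟨h, hpq⟩ s(r, b) ⟨hab, hnab⟩
        rw [Sym2.eq_iff] at this
        rcases this with ⟨rfl, rfl⟩ | ⟨rfl, rfl⟩
        · exact Or.inl (Reachable.refl _)
        · exact Or.inr (Reachable.refl _)
  · push Not at hne
    refine ⟨v, v, fun x => Or.inl ?_⟩
    exact (hT.connected.preconnected v x).mono (fun a b h => hne a b h)

lemma first_part [Fintype V] (G : SimpleGraph V) (hconn : G.Connected)
    (hcyc : ∃ (u : V) (w : G.Walk u u), w.IsCycle)
    (hnot : ¬ DecomposesIntoEvenAndEdges G (Fintype.card V - 3)) : IsK4WithHangingTrees G := by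
  classical
  obtain ⟨H, hH⟩ := exists_maxEven G
  have hac := hH.acyclic
  have hcard : Fintype.card V ≤ (G \ H).edgeSet.ncard + 2 := by
    by_contra hc
    apply hnot
    refine ⟨H, hH.le, fun v => Nat.not_odd_iff_even.1 (hH.even v), ?_⟩
    rw [← edgeSet_sdiff]
    omega
  obtain ⟨a0, b0, hab0⟩ := two_classes hconn sdiff_le hac hcard
  have three : ∀ x y z, ¬ (G \ H).Reachable x y → ¬ (G \ H).Reachable x z →
      (G \ H).Reachable y z := by
    intro x y z h1 h2
    rcases hab0 x with hx | hx <;> rcases hab0 y with hy | hy <;> rcases hab0 z with hz | hz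
    all_goals first
      | exact hy.symm.trans hz
      | exact absurd (hx.symm.trans hy) h1
      | exact absurd (hx.symm.trans hz) h2
  -- `H` has an edge
  obtain ⟨a, b, hab⟩ : ∃ a b, H.Adj a b := by
    by_contra! hc
    obtain ⟨u, w, hw⟩ := hcyc
    have : G ≤ G \ H := fun x y hxy => ⟨hxy, hc x y⟩
    exact (hac.anti this) w hw
  have adjF : ∀ x x' y z, H.Adj x y → H.Adj x' z → x ≠ x' → (G \ H).Reachable x x' →
      (G \ H).Adj x x' := by
    intro x x' y z hxy hxz hne hr
    obtain ⟨y', hy', hne'⟩ : ∃ y', H.Adj x' y' ∧ y' ≠ y := by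
      by_cases hzy : z = y
      · subst hzy; exact exists_other (hH.even x') hxz
      · exact ⟨z, hxz, hzy⟩
    refine hH.adj_of_two hxy hy' hne hne'.symm hr ?_
    exact three x y y' (hH.not_reachable hxy)
      (fun h => hH.not_reachable hy' (hr.symm.trans h))
  obtain ⟨b', hab', hbb'⟩ := exists_other (hH.even a) hab
  obtain ⟨a', ha'b, haa'⟩ := exists_other (hH.even b) hab.symm
  have rb : (G \ H).Reachable b b' := three a b b' (hH.not_reachable hab) (hH.not_reachable hab')
  have ra : (G \ H).Reachable a a' :=
    three b a a' (hH.not_reachable hab.symm) (hH.not_reachable ha'b)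
  have nab := hH.not_reachable hab
  have Fa : (G \ H).Adj a a' := adjF _ _ _ _ hab ha'b.symm haa'.symm ra
  have Fb : (G \ H).Adj b b' := adjF _ _ _ _ hab.symm hab'.symm hbb'.symm rb
  have tri : ∀ x y z, (G \ H).Adj x y → (G \ H).Adj x z → (G \ H).Adj y z → False := by
    intro x y z h1 h2 h3
    exact hac.cliqueFree le_rfl {x, y, z} (is3Clique_triple_iff.2 ⟨h1, h2, h3⟩)
  have inA : ∀ x y, H.Adj x y → (G \ H).Reachable a x → x = a ∨ x = a' := by
    intro x y hxy hr
    by_contra! hc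
    exact tri a a' x Fa (adjF _ _ _ _ hab hxy hc.1.symm hr)
      (adjF _ _ _ _ ha'b.symm hxy hc.2.symm (ra.symm.trans hr))
  have inB : ∀ x y, H.Adj x y → (G \ H).Reachable b x → x = b ∨ x = b' := by
    intro x y hxy hr
    by_contra! hc
    exact tri b b' x Fb (adjF _ _ _ _ hab.symm hxy hc.1.symm hr)
      (adjF _ _ _ _ hab'.symm hxy hc.2.symm (rb.symm.trans hr))
  have allr : ∀ x, (G \ H).Reachable a x ∨ (G \ H).Reachable b x := by
    intro x
    by_cases h : (G \ H).Reachable a x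
    · exact Or.inl h
    · exact Or.inr (three a b x nab h)
  have inS : ∀ x y, H.Adj x y → x ∈ ({a, a', b, b'} : Finset V) := by
    intro x y hxy
    simp only [Finset.mem_insert, Finset.mem_singleton]
    rcases allr x with h | h
    · rcases inA x y hxy h with h | h <;> simp [h]
    · rcases inB x y hxy h with h | h <;> simp [h]
  have ha'b' : H.Adj a' b' := by
    obtain ⟨z, hz, hzb⟩ := exists_other (hH.even a') ha'b.symm
    have : (G \ H).Reachable b z := three a' b z (hH.not_reachable ha'b.symm) (hH.not_reachable hz)
    rcases inB z a' hz.symm this with h | h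
    · exact absurd h hzb
    · exact h ▸ hz
  have nz : ∀ x ∈ ({a, a', b, b'} : Finset V), ∃ y, H.Adj x y := by
    intro x hx
    simp only [Finset.mem_insert, Finset.mem_singleton] at hx
    rcases hx with rfl | rfl | rfl | rfl
    exacts [⟨_, hab⟩, ⟨_, ha'b.symm⟩, ⟨_, hab.symm⟩, ⟨_, hab'.symm⟩]
  have L_le : G.deleteEdges {e : Sym2 V | ∀ x ∈ e, x ∈ ({a, a', b, b'} : Finset V)} ≤ G \ H := by
    intro x y hxy
    rw [deleteEdges_adj] at hxy
    refine ⟨hxy.1, fun h => hxy.2 ?_⟩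
    intro z hz
    rw [Sym2.mem_iff] at hz
    rcases hz with rfl | rfl
    exacts [inS _ _ h, inS _ _ h.symm]
  refine ⟨{a, a', b, b'}, ?_, ?_, hac.anti L_le, ?_⟩
  · have := hab.ne
    have := hab'.ne
    have := ha'b.ne
    have := ha'b'.ne
    rw [Finset.card_insert_of_notMem (by simp; grind), Finset.card_insert_of_notMem (by simp; grind),
      Finset.card_pair (by grind)]
  · have g1 := hH.le hab
    have g2 := hH.le hab'
    have g3 := hH.le ha'b
    have g4 := hH.le ha'b'
    have g5 := Fa.1
    have g6 := Fb.1
    intro u hu v hv huv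
    simp only [Finset.mem_insert, Finset.mem_singleton] at hu hv
    rcases hu with rfl | rfl | rfl | rfl <;> rcases hv with rfl | rfl | rfl | rfl <;>
      first | assumption | (apply SimpleGraph.Adj.symm; assumption) | exact absurd rfl huv
  · intro c
    induction c using ConnectedComponent.ind with | h v =>
    obtain ⟨S, hS⟩ : ∃ S, S = ({a, a', b, b'} : Finset V) := ⟨_, rfl⟩
    rw [← hS] at L_le inS nz ⊢
    have ex : ∀ s v, s ∈ S → (G \ H).Reachable s v →
        ∃ u ∈ S, (G.deleteEdges {e : Sym2 V | ∀ x ∈ e, x ∈ S}).Reachable u v := by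
      intro s v hs hr
      obtain ⟨w⟩ := hr.symm
      induction w with
      | nil => exact ⟨_, hs, Reachable.refl _⟩
      | @cons p q r h w ih =>
        obtain ⟨u, hu, hur⟩ := ih hs (w.reachable.symm)
        by_cases hpq : (p ∈ S ∧ q ∈ S)
        · exact ⟨p, hpq.1, Reachable.refl _⟩
        · refine ⟨u, hu, hur.trans (Adj.reachable ?_)⟩
          rw [deleteEdges_adj]
          refine ⟨h.1.symm, fun hh => hpq ⟨hh p (by simp), hh q (by simp)⟩⟩
    obtain ⟨u, hu, hur⟩ : ∃ u ∈ S,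
        (G.deleteEdges {e : Sym2 V | ∀ x ∈ e, x ∈ S}).Reachable u v := by
      rcases allr v with h | h
      · exact ex a v (by simp [hS]) h
      · exact ex b v (by simp [hS]) h
    refine ⟨u, ⟨hu, ConnectedComponent.eq.2 hur⟩, ?_⟩
    rintro s ⟨hs, hsr⟩
    have hsr := ConnectedComponent.eq.1 hsr
    by_contra hne
    have hr := hsr.trans hur.symm
    obtain ⟨y, hy⟩ := nz s hs
    obtain ⟨z, hz⟩ := nz u hu
    have hadj := adjF s u y z hy hz hne (hr.mono L_le)
    have hbr := isAcyclic_iff_forall_adj_isBridge.1 hac hadj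
    rw [isBridge_iff] at hbr
    apply hbr
    refine hr.mono ?_
    intro p q hpq
    rw [deleteEdges_adj]
    refine ⟨L_le hpq, fun h => ?_⟩
    rw [deleteEdges_adj] at hpq
    apply hpq.2
    rw [Set.mem_singleton_iff] at h
    rw [h]
    intro x hx
    rw [Sym2.mem_iff] at hx
    rcases hx with rfl | rfl <;> assumption

/-- An even subgraph contains no edge that leaves a set alone. -/
lemma no_single_cut [Fintype V] {H : SimpleGraph V} (he : ∀ x, ¬ oddAt H x) (D : Set V) {x y : V}
    (hxy : H.Adj x y) (hx : x ∉ D) (hy : y ∈ D)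
    (hcl : ∀ u v, H.Adj u v → u ∈ D → v ∉ D → u = y ∧ v = x) : False := by
  classical
  let K : SimpleGraph V :=
    { Adj := fun u v => H.Adj u v ∧ u ∈ D ∧ v ∈ D
      symm := ⟨fun u v h => ⟨h.1.symm, h.2.2, h.2.1⟩⟩
      loopless := ⟨fun u h => h.1.ne rfl⟩ }
  have conv : ∀ v, Odd (K.degree v) ↔ oddAt K v := by
    intro v
    unfold oddAt
    rw [← card_neighborSet_eq_degree, Set.ncard_eq_toFinset_card', Set.toFinset_card]
  have hKy : oddAt K y := by
    have h1 : K.neighborSet y = symmDiff (H.neighborSet y) {x} := by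
      ext v
      simp only [mem_neighborSet, Set.mem_symmDiff, Set.mem_singleton_iff]
      change (H.Adj y v ∧ y ∈ D ∧ v ∈ D) ↔ _
      have := hcl y v
      have := hxy.symm
      grind
    unfold oddAt
    rw [h1, odd_ncard_symmDiff]
    have := he y
    unfold oddAt at this
    simp [this]
  obtain ⟨z, hz, hzo⟩ := K.exists_ne_odd_degree_of_exists_odd_degree y ((conv y).2 hKy)
  rw [conv] at hzo
  obtain ⟨t, ht⟩ := hzo.exists_adj
  apply he z
  unfold oddAt at hzo ⊢
  convert hzo using 2
  ext v
  simp only [mem_neighborSet]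
  change _ ↔ (H.Adj z v ∧ z ∈ D ∧ v ∈ D)
  have h3 : z ∈ D := ht.2.1
  have := hcl z v
  grind

lemma second_part [Fintype V] (G : SimpleGraph V)
    (hd : DecomposesIntoEvenAndEdges G (Fintype.card V - 3)) (hk : IsK4WithHangingTrees G) :
    False := by
  classical
  obtain ⟨H, hle, heven, hcard⟩ := hd
  obtain ⟨S, hS4, hclq, hac, hcomp⟩ := hk
  have he : ∀ x, ¬ oddAt H x := fun x => Nat.not_odd_iff_even.2 (heven x)
  obtain ⟨L, hL⟩ : ∃ L, L = G.deleteEdges {e : Sym2 V | ∀ x ∈ e, x ∈ S} := ⟨_, rfl⟩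
  rw [← hL] at hac hcomp
  have hLadj : ∀ u v, L.Adj u v ↔ G.Adj u v ∧ ¬ (u ∈ S ∧ v ∈ S) := by
    intro u v
    rw [hL, deleteEdges_adj]
    simp
  have uniq : ∀ s ∈ S, ∀ t ∈ S, L.Reachable s t → s = t := by
    intro s hs t ht hr
    exact (hcomp (L.connectedComponentMk t)).unique ⟨hs, ConnectedComponent.eq.2 hr⟩ ⟨ht, rfl⟩
  have cut : ∀ x y, L.Adj x y → H.Adj x y →
      (∃ s ∈ S, (L.deleteEdges {s(x, y)}).Reachable y s) := by
    intro x y hxy hH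
    by_contra! hno
    have hbr := isAcyclic_iff_forall_adj_isBridge.1 hac hxy
    rw [isBridge_iff] at hbr
    refine no_single_cut he {v | (L.deleteEdges {s(x, y)}).Reachable y v} hH
      (fun h => hbr h.symm) (Reachable.refl _) ?_
    intro u v huv hu hv
    have huS : u ∉ S := fun h => hno u h hu
    have hLuv : L.Adj u v := (hLadj u v).2 ⟨hle huv, fun h => huS h.1⟩
    by_cases hc : s(u, v) = s(x, y)
    · rw [Sym2.eq_iff] at hc
      rcases hc with ⟨rfl, rfl⟩ | ⟨rfl, rfl⟩
      · exact absurd hu.symm hbr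
      · exact ⟨rfl, rfl⟩
    · exact absurd (hu.trans (Adj.reachable (by rw [deleteEdges_adj]; exact ⟨hLuv, hc⟩))) hv
  have LH : ∀ x y, L.Adj x y → ¬ H.Adj x y := by
    intro x y hxy hH
    obtain ⟨s, hs, hsr⟩ := cut x y hxy hH
    obtain ⟨t, ht, htr⟩ := cut y x hxy.symm hH.symm
    rw [Sym2.eq_swap] at htr
    have hst : s = t := uniq s hs t ht
      (((hsr.symm.mono (deleteEdges_le _)).trans hxy.symm.reachable).trans
        (htr.mono (deleteEdges_le _)))
    subst hst
    have hbr := isAcyclic_iff_forall_adj_isBridge.1 hac hxy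
    rw [isBridge_iff] at hbr
    exact hbr (htr.trans hsr.symm)
  have L_le : L ≤ G \ H := fun x y hxy => ⟨((hLadj x y).1 hxy).1, LH x y hxy⟩
  -- every vertex of `S` has a non-`H` neighbour in `S`
  have nbr : ∀ s ∈ S, ∃ t ∈ S, (G \ H).Adj s t := by
    intro s hs
    by_contra! hno
    apply he s
    have : H.neighborSet s = (S.erase s : Finset V) := by
      ext t
      simp only [mem_neighborSet, Finset.coe_erase, Set.mem_diff, Set.mem_singleton_iff,
        Finset.mem_coe]
      constructor
      · intro h
        refine ⟨?_, h.ne'⟩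
        by_contra ht
        exact LH s t ((hLadj s t).2 ⟨hle h, fun h => ht h.2⟩) h
      · rintro ⟨ht, hne⟩
        by_contra h
        exact hno t ht ⟨hclq s hs t ht (Ne.symm hne), h⟩
    unfold oddAt
    rw [this, Set.ncard_coe_finset, Finset.card_erase_of_mem hs, hS4]
    decide
  obtain ⟨a, ha⟩ : S.Nonempty := by rw [← Finset.card_pos]; omega
  obtain ⟨b, hb, hab⟩ := nbr a ha
  have hab_ne := hab.ne
  have c2 : ((S.erase a).erase b).card = 2 := by
    rw [Finset.card_erase_of_mem (by simp [hb, hab_ne.symm]), Finset.card_erase_of_mem ha, hS4]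
  obtain ⟨c, d, hcd, hScd⟩ := Finset.card_eq_two.1 c2
  have memS : ∀ x, x ∈ S ↔ (x = a ∨ x = b ∨ x = c ∨ x = d) := by
    intro x
    have := congrArg (x ∈ ·) hScd
    simp at this
    grind
  have hac_ne : a ≠ c := by
    have : c ∈ (S.erase a).erase b := by rw [hScd]; simp
    simp at this
    grind
  obtain ⟨J, hJ⟩ : ∃ J, J = (G \ H) ⊔ edge a c := ⟨_, rfl⟩
  have leJ : (G \ H) ≤ J := hJ ▸ le_sup_left
  have jb : J.Reachable a b := (leJ hab).reachable
  have jc : J.Reachable a c := by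
    apply Adj.reachable
    rw [hJ, sup_adj, edge_adj]
    exact Or.inr ⟨Or.inl ⟨rfl, rfl⟩, hac_ne⟩
  have jd : J.Reachable a d := by
    obtain ⟨t, ht, hdt⟩ := nbr d ((memS d).2 (by simp))
    have hr := (leJ hdt).reachable.symm
    rcases (memS t).1 ht with rfl | rfl | rfl | rfl
    · exact hr
    · exact jb.trans hr
    · exact jc.trans hr
    · exact absurd rfl hdt.ne
  have jS : ∀ s ∈ S, J.Reachable a s := by
    intro s hs
    rcases (memS s).1 hs with rfl | rfl | rfl | rfl
    exacts [Reachable.refl _, jb, jc, jd]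
  have jall : ∀ v, J.Reachable a v := by
    intro v
    obtain ⟨s, ⟨hs, hsr⟩, -⟩ := hcomp (L.connectedComponentMk v)
    exact (jS s hs).trans ((ConnectedComponent.eq.1 hsr).mono (L_le.trans leJ))
  have jconn : J.Connected := by
    haveI : Nonempty V := ⟨a⟩
    exact Connected.mk (fun u v => (jall u).symm.trans (jall v))
  have h1 := jconn.card_vert_le_card_edgeSet_add_one
  rw [Nat.card_eq_fintype_card (α := V), Nat.card_coe_set_eq] at h1
  have h2 : J.edgeSet ⊆ insert s(a, c) (G.edgeSet \ H.edgeSet) := by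
    intro e
    induction e with | h x y =>
    rw [mem_edgeSet, hJ, sup_adj, edge_adj]
    rintro (h | h)
    · exact Or.inr ⟨h.1, h.2⟩
    · left
      rw [Sym2.eq_iff]
      grind
  have h3 := (Set.ncard_le_ncard h2 (Set.toFinite _)).trans (Set.ncard_insert_le _ _)
  have h4 : 4 ≤ Fintype.card V := hS4 ▸ Finset.card_le_univ S
  omega

end EvenDec

/-- For a connected simple graph `G` on `n` vertices containing a cycle,
exactly one of the following holds: (i) `E(G)` can be partitioned into the edge set of an
even subgraph together with at most `n - 3` single edges; or (ii) `G` is a `K₄` with a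
vertex-disjoint tree hanging off each of its four vertices. -/
theorem even_edges_decomposition_dichotomy
    {V : Type*} [Fintype V] [DecidableEq V] (G : SimpleGraph V)
    (hconn : G.Connected)
    (hcyc : ∃ (u : V) (w : G.Walk u u), w.IsCycle) :
    (DecomposesIntoEvenAndEdges G (Fintype.card V - 3) ∨ IsK4WithHangingTrees G) ∧
    ¬(DecomposesIntoEvenAndEdges G (Fintype.card V - 3) ∧ IsK4WithHangingTrees G) := by
  constructor
  · by_cases h : DecomposesIntoEvenAndEdges G (Fintype.card V - 3)
    · exact Or.inl h
    · exact Or.inr (EvenDec.first_part G hconn hcyc h)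
  · rintro ⟨h1, h2⟩
    exact EvenDec.second_part G h1 h2
end

section
/- If G is a claw-free simple graph on n vertices, then the edge set of G can be partitioned into at most n-1 parts, each of which is either the edge set of a 2-regular subgraph of G or a single edge; in particular re(G) ≤ n-1. -/
/-- `s` is the edge set of a (not necessarily spanning) `2`-regular subgraph of `G`:
a subgraph in which every vertex has degree `0` (i.e. is not used) or exactly `2`. -/
def IsTwoRegularEdgeSet {V : Type*} (G : SimpleGraph V) (s : Set (Sym2 V)) : Prop :=
  ∃ H : SimpleGraph V, H ≤ G ∧
    (∀ v : V, (H.neighborSet v).ncard = 0 ∨ (H.neighborSet v).ncard = 2) ∧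
    s = H.edgeSet

/-- number of ends of `e` equal to `u` -/
def cnt {V : Type*} [DecidableEq V] (u : V) (e : Sym2 V) : ℕ :=
  Sym2.lift ⟨fun a b => (if u = a then 1 else 0) + (if u = b then 1 else 0),
    fun a b => by simp only [add_comm]⟩ e

lemma cnt_mk {V : Type*} [DecidableEq V] (u a b : V) :
    cnt u s(a, b) = (if u = a then 1 else 0) + (if u = b then 1 else 0) := rfl

/-- parity of the number of ends at `u` in the list. -/
def lb {V : Type*} [DecidableEq V] (u : V) (Q : List (Sym2 V)) : ZMod 2 :=
  (Q.map (fun e => (cnt u e : ZMod 2))).sum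

lemma lb_nil {V : Type*} [DecidableEq V] (u : V) : lb u [] = 0 := rfl

lemma lb_cons {V : Type*} [DecidableEq V] (u a b : V) (Q : List (Sym2 V)) :
    lb u (s(a, b) :: Q) = (if u = a then 1 else 0) + (if u = b then 1 else 0) + lb u Q := by
  simp [lb, cnt_mk]

/-- parity of the degree -/
def bd {V : Type*} [DecidableEq V] (S : Finset (Sym2 V)) (u : V) : ZMod 2 :=
  ∑ e ∈ S, (cnt u e : ZMod 2)

lemma add_list {V : Type*} [DecidableEq V] (E : Finset (Sym2 V)) (Q : List (Sym2 V))
    (S₀ : Finset (Sym2 V)) (h0 : S₀ ⊆ E) (hQ : ∀ e ∈ Q, e ∈ E) :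
    ∃ S ⊆ E, S.card ≤ S₀.card + Q.length ∧ ∀ u, bd S u = bd S₀ u + lb u Q := by
  induction Q with
  | nil => exact ⟨S₀, h0, by simp, by simp [lb]⟩
  | cons e Q ih =>
    obtain ⟨S, hS, hc, hb⟩ := ih (fun e he => hQ e (by simp [he]))
    by_cases he : e ∈ S
    · refine ⟨S.erase e, (Finset.erase_subset _ _).trans hS, ?_, fun u => ?_⟩
      · have := Finset.card_erase_le (s := S) (a := e)
        simp; omega
      · have h1 : (cnt u e : ZMod 2) + bd (S.erase e) u = bd S u :=
          Finset.add_sum_erase S (fun e => (cnt u e : ZMod 2)) he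
        have h2 : (cnt u e : ZMod 2) + (cnt u e : ZMod 2) = 0 := CharTwo.add_self_eq_zero _
        simp only [lb, List.map_cons, List.sum_cons] at hb ⊢
        have := hb u
        linear_combination h1 + this - h2
    · refine ⟨insert e S, Finset.insert_subset (hQ e (by simp)) hS, ?_, fun u => ?_⟩
      · rw [Finset.card_insert_of_notMem he]; simp; omega
      · have h1 : bd (insert e S) u = (cnt u e : ZMod 2) + bd S u := Finset.sum_insert he
        simp only [lb, List.map_cons, List.sum_cons] at hb ⊢
        rw [h1, hb u]; ring

lemma bd_toFinset {V : Type*} [DecidableEq V] (P : List (Sym2 V)) (hP : P.Nodup) (u : V) :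
    bd P.toFinset u = lb u P := by
  unfold bd lb
  rw [List.sum_toFinset _ hP]

/-- existence of the minimal parity-correcting set -/
lemma exists_min {V : Type*} [DecidableEq V] (E : Finset (Sym2 V)) :
    ∃ F ⊆ E, (∀ u, bd (E \ F) u = 0) ∧
      ∀ P Q : List (Sym2 V), P.Nodup → (∀ e ∈ P, e ∈ F) → (∀ e ∈ Q, e ∈ E) →
        (∀ u, lb u P = lb u Q) → P.length ≤ Q.length := by
  classical
  obtain ⟨F, hF, hmin⟩ := Finset.exists_min_image
    (E.powerset.filter (fun S => ∀ u, bd S u = bd E u)) Finset.card ⟨E, by simp⟩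
  simp only [Finset.mem_filter, Finset.mem_powerset, and_imp] at hF hmin
  have key : ∀ S T : Finset (Sym2 V), T ⊆ S → ∀ u, bd (S \ T) u + bd T u = bd S u :=
    fun S T h u => Finset.sum_sdiff h
  refine ⟨F, hF.1, fun u => ?_, ?_⟩
  · have := key E F hF.1 u
    rw [hF.2 u] at this
    simpa using this
  · intro P Q hP hPF hQ hb
    have hPF' : P.toFinset ⊆ F := fun e he => hPF e (by simpa using he)
    obtain ⟨S, hS, hc, hSb⟩ := add_list E Q (F \ P.toFinset)
      (Finset.sdiff_subset.trans hF.1) hQ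
    have := hmin S hS (fun u => by
      rw [hSb u, ← hb u, ← bd_toFinset P hP, key F _ hPF', hF.2])
    have h2 := Finset.card_sdiff_add_card_eq_card hPF'
    rw [List.toFinset_card_of_nodup hP] at h2
    omega

/-- The degree sum over a union of components is even. -/
lemma sum_bd {V : Type*} [Fintype V] [DecidableEq V] (S : Finset (Sym2 V)) (C : V → Prop)
    [DecidablePred C] (hC : ∀ a b, s(a, b) ∈ S → (C a ↔ C b)) :
    ∑ u with C u, bd S u = 0 := by
  unfold bd
  rw [Finset.sum_comm]
  apply Finset.sum_eq_zero
  intro e he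
  induction e with | _ a b
  have := hC a b he
  simp only [cnt_mk, Nat.cast_add, Nat.cast_ite, Finset.sum_add_distrib, Nat.cast_one, Nat.cast_zero]
  rw [Finset.sum_ite_eq', Finset.sum_ite_eq']
  by_cases h : C a
  · have h' := this.1 h
    simp [h, h']; rfl
  · have h' : ¬ C b := fun h' => h (this.2 h')
    simp [h, h']

lemma forest_count {V : Type*} [Fintype V] [DecidableEq V] (F : Finset (Sym2 V))
    (hmin : ∀ P : List (Sym2 V), P.Nodup → (∀ e ∈ P, e ∈ F) →
        (∀ u, lb u P = 0) → P.length ≤ 0)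
    {κ : Type*} [DecidableEq κ] (c : V → κ) (hc : ∀ a b, s(a, b) ∈ F → c a = c b)
    (A : Finset V) (hA : ∀ a ∈ A, ∀ b ∈ A, c a = c b → a = b) :
    F.card + A.card ≤ Fintype.card V := by
  have hinj : Set.InjOn (fun x : Finset (Sym2 V) × Finset V =>
      fun u => bd x.1 u + (if u ∈ x.2 then (1 : ZMod 2) else 0))
      ((F.powerset ×ˢ A.powerset : Finset _) : Set (Finset (Sym2 V) × Finset V)) := by
    rintro ⟨S, B⟩ h1 ⟨S', B'⟩ h2 heq
    simp only [Finset.coe_product, Set.mem_prod, Finset.mem_coe, Finset.mem_powerset] at h1 h2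
    have heq' : ∀ u, bd S u + (if u ∈ B then (1 : ZMod 2) else 0) =
      bd S' u + (if u ∈ B' then (1 : ZMod 2) else 0) := fun u => congrFun heq u
    have hsum : ∀ a ∈ A, ∀ B ⊆ A, ∑ u with c u = c a, (if u ∈ B then (1 : ZMod 2) else 0) =
        if a ∈ B then 1 else 0 := by
      intro a ha B hB
      rw [Finset.sum_eq_single a]
      · intro b hb hba
        rw [if_neg]
        intro hbB
        exact hba (hA _ (hB hbB) _ ha (by simpa using hb))
      · simp
    have hBB : B = B' := by
      have : ∀ a ∈ A, (a ∈ B ↔ a ∈ B') := by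
        intro a ha
        have := Finset.sum_congr (s₁ := Finset.univ.filter (fun u => c u = c a)) rfl
          (fun u _ => heq' u)
        rw [Finset.sum_add_distrib, Finset.sum_add_distrib,
          sum_bd S (fun u => c u = c a) (fun x y h => by rw [hc x y (h1.1 h)]),
          sum_bd S' (fun u => c u = c a) (fun x y h => by rw [hc x y (h2.1 h)]),
          hsum a ha B h1.2, hsum a ha B' h2.2] at this
        by_cases p : a ∈ B <;> by_cases q : a ∈ B' <;> simp_all
      ext a
      exact ⟨fun h => (this a (h1.2 h)).1 h, fun h => (this a (h2.2 h)).2 h⟩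
    subst hBB
    have hbd : ∀ u, bd S u = bd S' u := fun u => by simpa using heq' u
    obtain ⟨T, hT, -, hTb⟩ : ∃ T : Finset (Sym2 V), T = (S \ S') ∪ (S' \ S) ∧ True ∧
        ∀ u, bd T u = 0 := by
      refine ⟨_, rfl, trivial, fun u => ?_⟩
      have e1 : bd ((S \ S') ∪ (S' \ S)) u = bd (S \ S') u + bd (S' \ S) u :=
        Finset.sum_union (disjoint_sdiff_sdiff)
      have e2 : bd (S ∩ S') u + bd (S \ S') u = bd S u := Finset.sum_inter_add_sum_sdiff S S' _
      have e3 : bd (S' ∩ S) u + bd (S' \ S) u = bd S' u := Finset.sum_inter_add_sum_sdiff S' S _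
      rw [Finset.inter_comm] at e3
      have h2 : bd (S \ S') u + bd (S \ S') u = 0 := CharTwo.add_self_eq_zero _
      have := hbd u
      linear_combination e1 + e3 - e2 + h2 - this
    have h0 := hmin T.toList T.nodup_toList (fun e he => by
        have : e ∈ T := by simpa using he
        rw [hT] at this
        simp only [Finset.mem_union, Finset.mem_sdiff] at this
        rcases this with h | h
        · exact h1.1 h.1
        · exact h2.1 h.1) (fun u => by
        rw [← bd_toFinset _ T.nodup_toList]; simpa using hTb u)
    have hT0 : T = ∅ := by simpa using h0
    rw [hT] at hT0
    have : S = S' := by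
      have h3 := Finset.union_eq_empty.1 hT0
      exact Finset.Subset.antisymm (Finset.sdiff_eq_empty_iff_subset.1 h3.1)
        (Finset.sdiff_eq_empty_iff_subset.1 h3.2)
    rw [this]
  have := Finset.card_le_card_of_injOn (t := (Finset.univ : Finset (V → ZMod 2))) _ (by simp) hinj
  rw [Finset.card_product, Finset.card_powerset, Finset.card_powerset, Finset.card_univ,
    Fintype.card_fun, ZMod.card, ← pow_add] at this
  exact (Nat.pow_le_pow_iff_right (by norm_num)).1 this

/-- balanced orientation -/
lemma orient {V : Type*} [DecidableEq V] (n : ℕ) : ∀ (E : Finset (Sym2 V)) (x y : V),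
    E.card = n → (∀ a, s(a, a) ∉ E) →
    (∀ u, bd E u = (if u = x then 1 else 0) + (if u = y then 1 else 0)) →
    ∃ A : Finset (V × V), (∀ a b, (a, b) ∈ A → (b, a) ∉ A) ∧
      (∀ a b, s(a, b) ∈ E ↔ (a, b) ∈ A ∨ (b, a) ∈ A) ∧
      (∀ u, (A.filter (fun p => p.1 = u)).card + (if u = y then 1 else 0) =
        (A.filter (fun p => p.2 = u)).card + (if u = x then 1 else 0)) ∧
      (∀ u, (A.filter (fun p => p.1 = u)).card + (A.filter (fun p => p.2 = u)).card
        = ∑ e ∈ E, cnt u e) := by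
  induction n with
  | zero =>
    intro E x y hE _ hb
    have : E = ∅ := by simpa using hE
    subst this
    have hxy : x = y := by
      by_contra h
      have := hb x
      simp [bd, h] at this
    subst hxy
    exact ⟨∅, by simp, by simp, by simp, by simp⟩
  | succ n ih =>
    intro E x y hE hd hb
    -- choose an arc `(a, z)`, with `a = x` if `x ≠ y`
    have : ∃ a z, s(a, z) ∈ E ∧ (x ≠ y → a = x) := by
      by_cases hxy : x = y
      · have : E.Nonempty := by rw [← Finset.card_pos]; omega
        obtain ⟨e, he⟩ := this
        induction e with | _ a b
        exact ⟨a, b, he, fun h => absurd hxy h⟩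
      · have h1 := hb x
        simp only [if_true, hxy, if_false, add_zero] at h1
        have : ∃ e ∈ E, (cnt x e : ZMod 2) ≠ 0 := by
          by_contra h
          push Not at h
          rw [bd, Finset.sum_eq_zero h] at h1
          exact absurd h1 (by decide)
        obtain ⟨e, he, hc⟩ := this
        induction e with | _ a b
        by_cases hxa : x = a
        · subst hxa; exact ⟨x, b, he, fun _ => rfl⟩
        · by_cases hxb : x = b
          · subst hxb; exact ⟨x, a, by rwa [Sym2.eq_swap], fun _ => rfl⟩
          · simp [cnt_mk, hxa, hxb] at hc
    obtain ⟨a, z, he, hax⟩ := this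
    have haz : a ≠ z := fun h => hd a (by rw [h] at he ⊢; exact he)
    obtain ⟨x', y', hb', hdir⟩ : ∃ x' y', (∀ u, bd (E.erase s(a, z)) u =
        (if u = x' then 1 else 0) + (if u = y' then 1 else 0)) ∧
        (∀ u : V, (if u = a then 1 else 0) + (if u = x' then 1 else 0) + (if u = y then 1 else 0)
          = (if u = z then 1 else 0) + (if u = y' then 1 else 0) + (if u = x then 1 else 0)) := by
      have hh : ∀ u, bd (E.erase s(a, z)) u = bd E u + (if u = a then 1 else 0)
          + (if u = z then 1 else 0) := by
        intro u
        have h1 : (cnt u s(a, z) : ZMod 2) + bd (E.erase s(a, z)) u = bd E u :=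
          Finset.add_sum_erase E (fun e => (cnt u e : ZMod 2)) he
        have h2 : (cnt u s(a, z) : ZMod 2) + (cnt u s(a, z) : ZMod 2) = 0 :=
          CharTwo.add_self_eq_zero _
        have h3 : (cnt u s(a, z) : ZMod 2) = (if u = a then 1 else 0) + (if u = z then 1 else 0) := by
          simp [cnt_mk]
        linear_combination h1 - h2 + h3
      by_cases hxy : x = y
      · subst hxy
        refine ⟨z, a, fun u => ?_, fun u => ?_⟩
        · rw [hh, hb]
          have : ∀ t : ZMod 2, t + t = 0 := CharTwo.add_self_eq_zero
          rw [this]; ring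
        · ring
      · have := hax hxy
        subst this
        refine ⟨z, y, fun u => ?_, fun u => ?_⟩
        · rw [hh, hb]
          have : ∀ t : ZMod 2, t + t = 0 := CharTwo.add_self_eq_zero
          linear_combination this (if u = a then 1 else 0)
        · ring
    obtain ⟨A, hA1, hA2, hA3, hA4⟩ := ih (E.erase s(a, z)) x' y'
      (by rw [Finset.card_erase_of_mem he, hE]; rfl) (fun b hb => hd b (Finset.mem_of_mem_erase hb)) hb'
    have hn : (a, z) ∉ A := fun h => by
      have := (hA2 a z).2 (Or.inl h); simp at this
    have hn' : (z, a) ∉ A := fun h => by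
      have := (hA2 a z).2 (Or.inr h); simp at this
    have o1 : ∀ u, ((insert (a, z) A).filter (fun p => p.1 = u)).card =
        (A.filter (fun p => p.1 = u)).card + if u = a then 1 else 0 := by
      intro u
      rw [Finset.filter_insert]
      by_cases h : a = u
      · subst h
        simp [Finset.card_insert_of_notMem, hn]
      · simp [h, Ne.symm h]
    have o2 : ∀ u, ((insert (a, z) A).filter (fun p => p.2 = u)).card =
        (A.filter (fun p => p.2 = u)).card + if u = z then 1 else 0 := by
      intro u
      rw [Finset.filter_insert]
      by_cases h : z = u
      · subst h
        simp [Finset.card_insert_of_notMem, hn]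
      · simp [h, Ne.symm h]
    refine ⟨insert (a, z) A, ?_, ?_, ?_, ?_⟩
    · intro b c h
      simp only [Finset.mem_insert, Prod.mk.injEq, not_or, not_and] at h ⊢
      rcases h with ⟨rfl, rfl⟩ | h
      · exact ⟨fun h => absurd h.symm haz, hn'⟩
      · exact ⟨fun h1 h2 => by subst h1 h2; exact hn' h, hA1 _ _ h⟩
    · intro b c
      have := hA2 b c
      rw [Finset.mem_erase] at this
      simp only [Finset.mem_insert, Prod.mk.injEq]
      by_cases hbc : s(b, c) = s(a, z)
      · have h1 : s(b, c) ∈ E := hbc ▸ he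
        rw [Sym2.eq_iff] at hbc
        simp only [h1, true_iff]
        tauto
      · rw [Sym2.eq_iff] at hbc
        rw [Ne, Sym2.eq_iff] at this
        tauto
    · intro u
      rw [o1, o2]
      have h1 := hA3 u
      have h2 := hdir u
      omega
    · intro u
      rw [o1, o2, ← Finset.add_sum_erase _ _ he, ← hA4 u, cnt_mk]
      ring

lemma out_card {V : Type*} [Fintype V] [DecidableEq V] (A : Finset (V × V)) (u : V) :
    ∑ b : V, (if (u, b) ∈ A then 1 else 0) = (A.filter (fun p => p.1 = u)).card := by
  rw [Finset.sum_boole, Nat.cast_id]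
  refine Finset.card_bij (fun b _ => (u, b)) ?_ ?_ ?_
  · intro a ha; simpa using ha
  · intro a _ b _ h; simpa using h
  · rintro ⟨a, b⟩ h
    simp only [Finset.mem_filter] at h
    obtain ⟨h, rfl⟩ := h
    exact ⟨b, by simpa using h, rfl⟩

lemma in_card {V : Type*} [Fintype V] [DecidableEq V] (A : Finset (V × V)) (u : V) :
    ∑ b : V, (if (b, u) ∈ A then 1 else 0) = (A.filter (fun p => p.2 = u)).card := by
  rw [Finset.sum_boole, Nat.cast_id]
  refine Finset.card_bij (fun b _ => (b, u)) ?_ ?_ ?_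
  · intro a ha; simpa using ha
  · intro a _ b _ h; simpa using h
  · rintro ⟨a, b⟩ h
    simp only [Finset.mem_filter] at h
    obtain ⟨h, rfl⟩ := h
    exact ⟨a, by simpa using h, rfl⟩

/-- One permutation covering all vertices of maximal out-degree, by Hall's theorem. -/
lemma hall_step {V : Type*} [Fintype V] [DecidableEq V] (A : Finset (V × V)) (k : ℕ)
    (hA : ∀ a, (a, a) ∉ A)
    (hbal : ∀ u, (A.filter (fun p => p.1 = u)).card = (A.filter (fun p => p.2 = u)).card)
    (hk : ∀ u, (A.filter (fun p => p.1 = u)).card ≤ k + 1) :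
    ∃ f : Equiv.Perm V, (∀ a, f a ≠ a → (a, f a) ∈ A) ∧
      (∀ a, (A.filter (fun p => p.1 = a)).card = k + 1 → f a ≠ a) := by
  let w : V → V → ℕ := fun u b => (if (u, b) ∈ A then 1 else 0) +
    (if u = b then k + 1 - (A.filter (fun p => p.1 = u)).card else 0)
  have hw1 : ∀ u, ∑ b, w u b = k + 1 := by
    intro u
    simp only [w, Finset.sum_add_distrib]
    rw [out_card, Finset.sum_ite_eq]
    simp only [Finset.mem_univ, if_true]
    have := hk u
    omega
  have hw2 : ∀ b, ∑ u, w u b = k + 1 := by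
    intro b
    simp only [w, Finset.sum_add_distrib]
    rw [in_card, Finset.sum_ite_eq', ← hbal]
    simp only [Finset.mem_univ, if_true]
    have := hk b
    omega
  let t : V → Finset V := fun u => Finset.univ.filter (fun b => w u b ≠ 0)
  have hall := (Finset.all_card_le_biUnion_card_iff_exists_injective t).1 (by
    intro s
    have h1 : (k + 1) * s.card = ∑ u ∈ s, ∑ b ∈ s.biUnion t, w u b := by
      rw [mul_comm, ← smul_eq_mul, ← Finset.sum_const]
      refine Finset.sum_congr rfl (fun u hu => ?_)
      rw [← hw1 u]
      symm
      refine Finset.sum_subset (Finset.subset_univ _) (fun b _ hb => ?_)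
      by_contra h
      exact hb (Finset.mem_biUnion.2 ⟨u, hu, by simp [t, h]⟩)
    have h2 : ∑ u ∈ s, ∑ b ∈ s.biUnion t, w u b ≤ (k + 1) * (s.biUnion t).card := by
      rw [Finset.sum_comm, mul_comm, ← smul_eq_mul, ← Finset.sum_const]
      refine Finset.sum_le_sum (fun b _ => ?_)
      rw [← hw2 b]
      exact Finset.sum_le_sum_of_subset (Finset.subset_univ _)
    rw [← h1] at h2
    exact Nat.le_of_mul_le_mul_left h2 (Nat.succ_pos k))
  obtain ⟨f, hf, hft⟩ := hall
  refine ⟨Equiv.ofBijective f (Finite.injective_iff_bijective.1 hf), ?_, ?_⟩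
  · intro a ha
    simp only [Equiv.ofBijective_apply] at ha ⊢
    by_contra h
    have := hft a
    simp [t, w, h, Ne.symm ha] at this
  · intro a ha heq
    simp only [Equiv.ofBijective_apply] at heq
    have := hft a
    simp [t, w, heq, hA a, ha] at this

lemma perm_decomp {V : Type*} [Fintype V] [DecidableEq V] (k : ℕ) : ∀ (A : Finset (V × V)),
    (∀ a, (a, a) ∉ A) →
    (∀ u, (A.filter (fun p => p.1 = u)).card = (A.filter (fun p => p.2 = u)).card) →
    (∀ u, (A.filter (fun p => p.1 = u)).card ≤ k) →
    ∃ f : Fin k → Equiv.Perm V, (∀ i a, f i a ≠ a → (a, f i a) ∈ A) ∧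
      (∀ i j a, f i a ≠ a → f i a = f j a → i = j) ∧
      (∀ a b, (a, b) ∈ A → ∃ i, f i a = b) := by
  induction k with
  | zero =>
    intro A _ _ hk
    refine ⟨fun i => i.elim0, fun i => i.elim0, fun i => i.elim0, fun a b h => ?_⟩
    have := hk a
    have h0 : A.filter (fun p => p.1 = a) = ∅ := by simpa using this
    have : (a, b) ∈ A.filter (fun p => p.1 = a) := by simp [h]
    rw [h0] at this
    simp at this
  | succ k ih =>
    intro A hA hbal hk
    obtain ⟨f, hf1, hf2⟩ := hall_step A k hA hbal hk
    let B := A.filter (fun p => f p.1 ≠ p.2)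
    have hBo : ∀ u, (B.filter (fun p => p.1 = u)).card + (if f u = u then 0 else 1) =
        (A.filter (fun p => p.1 = u)).card := by
      intro u
      rw [← out_card, ← out_card]
      have : (if f u = u then 0 else 1) = ∑ b, (if f u = b then (if f u = u then 0 else 1) else 0) := by
        simp
      rw [this, ← Finset.sum_add_distrib]
      refine Finset.sum_congr rfl (fun b _ => ?_)
      by_cases h1 : f u = b
      · subst h1
        by_cases h2 : f u = u
        · simp [B, h2, hA]
        · simp [B, h2, hf1 u h2]
      · simp [B, h1]
    have hBi : ∀ u, (B.filter (fun p => p.2 = u)).card + (if f u = u then 0 else 1) =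
        (A.filter (fun p => p.2 = u)).card := by
      intro u
      rw [← in_card, ← in_card]
      have : (if f u = u then 0 else 1) =
          ∑ b, (if b = f.symm u then (if f u = u then 0 else 1) else 0) := by
        simp
      rw [this, ← Finset.sum_add_distrib]
      refine Finset.sum_congr rfl (fun b _ => ?_)
      by_cases h1 : f b = u
      · subst h1
        by_cases h2 : f b = b
        · simp [B, h2, hA]
        · simp [B, h2, hf1 b h2]
      · have : b ≠ f.symm u := fun h => h1 (by simp [h])
        simp [B, h1, this]
    obtain ⟨g, hg1, hg2, hg3⟩ := ih B (fun a h => hA a (Finset.mem_of_mem_filter _ h))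
      (fun u => by have := hBo u; have := hBi u; have := hbal u; omega)
      (fun u => by
        have h1 := hBo u
        have h2 := hk u
        have h3 := hf2 u
        by_cases h : f u = u
        · simp only [h, if_true] at h1
          have : (A.filter (fun p => p.1 = u)).card ≠ k + 1 := fun h' => h3 h' h
          omega
        · simp only [h, if_false] at h1
          omega)
    have hBA : ∀ a b, (a, b) ∈ B ↔ (a, b) ∈ A ∧ f a ≠ b := fun a b => by simp [B]
    refine ⟨Fin.cons f g, ?_, ?_, ?_⟩
    · intro i
      refine Fin.cases ?_ (fun i => ?_) i
      · simpa using hf1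
      · intro a ha
        simp only [Fin.cons_succ] at ha ⊢
        exact ((hBA _ _).1 (hg1 i a ha)).1
    · intro i j a
      refine Fin.cases ?_ (fun i => ?_) i <;> refine Fin.cases ?_ (fun j => ?_) j
      · simp
      · intro h1 h2
        simp only [Fin.cons_succ, Fin.cons_zero] at h1 h2
        exact absurd h2 ((hBA _ _).1 (hg1 j a (h2 ▸ h1))).2
      · intro h1 h2
        simp only [Fin.cons_succ, Fin.cons_zero] at h1 h2
        exact absurd h2.symm ((hBA _ _).1 (hg1 i a h1)).2
      · intro h1 h2
        simp only [Fin.cons_succ] at h1 h2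
        rw [hg2 i j a h1 h2]
    · intro a b hab
      by_cases h : f a = b
      · exact ⟨0, by simpa using h⟩
      · obtain ⟨i, hi⟩ := hg3 a b ((hBA _ _).2 ⟨hab, h⟩)
        exact ⟨i.succ, by simpa using hi⟩

/-- A set of edges with all degrees even and at most `2 k` splits into `k` two-regular parts. -/
lemma even_decomp {V : Type*} [Fintype V] [DecidableEq V] [Nonempty V] (G : SimpleGraph V)
    (E : Finset (Sym2 V))
    (hE : ∀ e ∈ E, e ∈ G.edgeSet) (hb : ∀ u, bd E u = 0) (k : ℕ)
    (hk : ∀ u, ∑ e ∈ E, cnt u e ≤ 2 * k) :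
    ∃ f : Fin k → Set (Sym2 V), (∀ i, IsTwoRegularEdgeSet G (f i)) ∧
      (∀ i j, i ≠ j → Disjoint (f i) (f j)) ∧ (∀ e, e ∈ E ↔ ∃ i, e ∈ f i) := by
  obtain ⟨x⟩ := ‹Nonempty V›
  have hd : ∀ a, s(a, a) ∉ E := fun a h => by
    have := hE _ h
    simp at this
  obtain ⟨A, hA1, hA2, hA3, hA4⟩ := orient _ E x x rfl hd
    (fun u => by rw [hb u]; exact (CharTwo.add_self_eq_zero _).symm)
  have hbal : ∀ u, (A.filter (fun p => p.1 = u)).card = (A.filter (fun p => p.2 = u)).card :=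
    fun u => by have := hA3 u; omega
  obtain ⟨f, hf1, hf2, hf3⟩ := perm_decomp k A (fun a h => hA1 a a h h) hbal
    (fun u => by
      have h1 := hA4 u
      have h2 := hk u
      have h3 := hbal u
      omega)
  let H : Fin k → SimpleGraph V := fun i =>
    { Adj := fun a b => a ≠ b ∧ (f i a = b ∨ f i b = a)
      symm := ⟨fun a b h => ⟨h.1.symm, h.2.symm⟩⟩
      loopless := ⟨fun a h => h.1 rfl⟩ }
  have hHA : ∀ i a b, (H i).Adj a b ↔ a ≠ b ∧ (f i a = b ∨ f i b = a) := fun i a b => Iff.rfl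
  have hHE : ∀ i a b, (H i).Adj a b → s(a, b) ∈ E := by
    rintro i a b ⟨h, h' | h'⟩
    · exact (hA2 a b).2 (Or.inl (h' ▸ hf1 i a (by rw [h']; exact h.symm)))
    · exact (hA2 a b).2 (Or.inr (h' ▸ hf1 i b (by rw [h']; exact h)))
  refine ⟨fun i => (H i).edgeSet, fun i => ⟨H i, fun a b h => ?_, fun v => ?_, rfl⟩, ?_, ?_⟩
  · have := hE _ (hHE i a b h)
    simpa using this
  · by_cases hv : f i v = v
    · left
      have : (H i).neighborSet v = ∅ := by
        ext b
        simp only [SimpleGraph.mem_neighborSet, hHA, Set.mem_empty_iff_false, iff_false]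
        rintro ⟨h, h' | h'⟩
        · exact h (by rw [← h', hv])
        · exact h ((f i).injective (by rw [hv, h']))
      rw [this]; simp
    · right
      have : (H i).neighborSet v = {f i v, (f i).symm v} := by
        ext b
        simp only [SimpleGraph.mem_neighborSet, hHA, Set.mem_insert_iff, Set.mem_singleton_iff]
        constructor
        · rintro ⟨h, h' | h'⟩
          · exact Or.inl h'.symm
          · right; rw [← h']; simp
        · rintro (rfl | rfl)
          · exact ⟨fun h => hv h.symm, Or.inl rfl⟩
          · refine ⟨fun h => hv ?_, Or.inr (by simp)⟩
            conv_lhs => rw [h]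
            simp
      rw [this, Set.ncard_pair]
      intro h
      have h1 := hf1 i v hv
      have h2 : f i (f i v) = v := by
        conv_lhs => rw [h]
        simp
      have h3 := hf1 i (f i v) (by rw [h2]; exact fun h => hv h.symm)
      rw [h2] at h3
      exact hA1 _ _ h1 h3
  · intro i j hij
    rw [Set.disjoint_left]
    intro e he he'
    induction e with | _ a b
    simp only [SimpleGraph.mem_edgeSet, hHA] at he he'
    obtain ⟨hab, h1⟩ := he
    obtain ⟨-, h2⟩ := he'
    have key : ∀ i a b, a ≠ b → f i a = b → (a, b) ∈ A := fun i a b hab h =>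
      h ▸ hf1 i a (by rw [h]; exact hab.symm)
    rcases h1 with h1 | h1 <;> rcases h2 with h2 | h2
    · exact hij (hf2 i j a (by rw [h1]; exact hab.symm) (by rw [h1, h2]))
    · exact hA1 _ _ (key i a b hab h1) (key j b a hab.symm h2)
    · exact hA1 _ _ (key i b a hab.symm h1) (key j a b hab h2)
    · exact hij (hf2 i j b (by rw [h1]; exact hab) (by rw [h1, h2]))
  · intro e
    induction e with | _ a b
    constructor
    · intro he
      have hab : a ≠ b := fun h => hd a (by rw [← h] at he; exact he)
      rcases (hA2 a b).1 he with h | h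
      · obtain ⟨i, hi⟩ := hf3 _ _ h
        exact ⟨i, hab, Or.inl hi⟩
      · obtain ⟨i, hi⟩ := hf3 _ _ h
        exact ⟨i, hab, Or.inr hi⟩
    · rintro ⟨i, hi⟩
      exact hHE i a b hi

lemma deg_eq {V : Type*} [Fintype V] [DecidableEq V] (S : Finset (Sym2 V))
    (hd : ∀ a, s(a, a) ∉ S) (v : V) :
    ∑ e ∈ S, cnt v e = (Finset.univ.filter (fun x => s(v, x) ∈ S)).card := by
  have h1 : ∀ e ∈ S, cnt v e = if v ∈ e then 1 else 0 := by
    intro e he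
    induction e with | _ a b
    have hab : a ≠ b := fun h => hd a (by rw [← h] at he; exact he)
    simp only [cnt_mk, Sym2.mem_iff]
    by_cases h1 : v = a
    · subst h1; simp [hab]
    · simp [h1]
  rw [Finset.sum_congr rfl h1, Finset.sum_boole, Nat.cast_id]
  symm
  refine Finset.card_bij (fun x _ => s(v, x)) ?_ ?_ ?_
  · intro x hx
    simp only [Finset.mem_filter, Finset.mem_univ, true_and] at hx
    simp [hx]
  · intro x _ y _ h
    exact Sym2.congr_right.1 h
  · intro e he
    simp only [Finset.mem_filter] at he
    obtain ⟨x, rfl⟩ := Sym2.mem_iff_exists.1 he.2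
    exact ⟨x, by simpa using he.1, rfl⟩

lemma lb_edges {V : Type*} [DecidableEq V] (G : SimpleGraph V) {x y : V} (p : G.Walk x y) (u : V) :
    lb u p.edges = (if u = x then 1 else 0) + (if u = y then 1 else 0) := by
  induction p with
  | nil => simp only [SimpleGraph.Walk.edges_nil, lb_nil]; exact (CharTwo.add_self_eq_zero _).symm
  | cons h p ih =>
    rename_i a b c
    rw [SimpleGraph.Walk.edges_cons, lb_cons, ih]
    have : ∀ t : ZMod 2, t + t = 0 := CharTwo.add_self_eq_zero
    linear_combination this (if u = b then 1 else 0)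

/-- The key inequality for the minimal set `F`. -/
lemma key_ineq {V : Type*} [Fintype V] [DecidableEq V] (G : SimpleGraph V)
    (hclaw : ∀ v a b c : V, G.Adj v a → G.Adj v b → G.Adj v c →
      a ≠ b → a ≠ c → b ≠ c → (G.Adj a b ∨ G.Adj a c ∨ G.Adj b c))
    (F : Finset (Sym2 V)) (hF : ∀ e ∈ F, e ∈ G.edgeSet)
    (hmin : ∀ P Q : List (Sym2 V), P.Nodup → (∀ e ∈ P, e ∈ F) → (∀ e ∈ Q, e ∈ G.edgeSet) →
        (∀ u, lb u P = lb u Q) → P.length ≤ Q.length)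
    (v : V) (N : Finset V) (hN : ∀ x ∈ N, G.Adj v x ∧ s(v, x) ∉ F) (hev : Even N.card) :
    F.card + N.card / 2 + 1 ≤ Fintype.card V := by
  classical
  have two : (2 : ZMod 2) = 0 := rfl
  have sw : ∀ {a b : V}, s(a, b) ∈ F → s(b, a) ∈ F := fun {a b} h => by rwa [Sym2.eq_swap]
  have FG : ∀ {a b : V}, s(a, b) ∈ F → G.Adj a b := fun {a b} h => by simpa using hF _ h
  have Fne : ∀ {a b : V}, s(a, b) ∈ F → a ≠ b := fun {a b} h => (FG h).ne
  have path2 : ∀ a b c, s(a, b) ∈ F → s(b, c) ∈ F → a ≠ c → G.Adj a c → False := by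
    intro a b c h1 h2 hac hG
    have h3 := Fne h1
    have h4 := Fne h2
    have := hmin [s(a, b), s(b, c)] [s(a, c)] (by clear two; simp; grind) (by simp [h1, h2]) (by simp [hG])
      (fun u => by simp only [lb_cons, lb_nil]; linear_combination (if u = b then 1 else 0) * two)
    simp at this
  have path3 : ∀ a b c d, s(a, b) ∈ F → s(b, c) ∈ F → s(c, d) ∈ F → a ≠ c → a ≠ d → b ≠ d →
      G.Adj a d → False := by
    intro a b c d h1 h2 h3 n1 n2 n3 hG
    have n4 := Fne h1
    have n5 := Fne h2
    have n6 := Fne h3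
    have := hmin [s(a, b), s(b, c), s(c, d)] [s(a, d)] (by clear two; simp; grind)
      (by simp [h1, h2, h3]) (by simp [hG])
      (fun u => by
        simp only [lb_cons, lb_nil]
        linear_combination ((if u = b then 1 else 0) + (if u = c then 1 else 0)) * two)
    simp at this
  have path4 : ∀ a b c d e, s(a, b) ∈ F → s(b, c) ∈ F → s(c, d) ∈ F → s(d, e) ∈ F →
      a ≠ c → a ≠ d → a ≠ e → b ≠ d → b ≠ e → c ≠ e → G.Adj a e → False := by
    intro a b c d e h1 h2 h3 h4 n1 n2 n3 n4 n5 n6 hG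
    have n7 := Fne h1
    have n8 := Fne h2
    have n9 := Fne h3
    have n10 := Fne h4
    have := hmin [s(a, b), s(b, c), s(c, d), s(d, e)] [s(a, e)] (by clear two; simp; grind)
      (by simp [h1, h2, h3, h4]) (by simp [hG])
      (fun u => by
        simp only [lb_cons, lb_nil]
        linear_combination ((if u = b then 1 else 0) + (if u = c then 1 else 0) +
          (if u = d then 1 else 0)) * two)
    simp at this
  let FF : SimpleGraph V := SimpleGraph.fromEdgeSet (F : Set (Sym2 V))
  have FFadj : ∀ {a b}, FF.Adj a b → s(a, b) ∈ F := fun {a b} h => by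
    have := (SimpleGraph.fromEdgeSet_adj _).1 h
    simpa using this.1
  let c : V → FF.ConnectedComponent := FF.connectedComponentMk
  have hcF : ∀ a b, s(a, b) ∈ F → c a = c b := by
    intro a b h
    apply SimpleGraph.ConnectedComponent.sound
    exact SimpleGraph.Adj.reachable ((SimpleGraph.fromEdgeSet_adj _).2 ⟨by simpa using h, Fne h⟩)
  have walk : ∀ x y, c x = c y → ∃ p : FF.Walk x y, p.IsPath ∧
      ∀ Q : List (Sym2 V), (∀ e ∈ Q, e ∈ G.edgeSet) →
        (∀ u, lb u Q = (if u = x then 1 else 0) + (if u = y then 1 else 0)) →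
        p.length ≤ Q.length := by
    intro x y h
    obtain ⟨p, hp⟩ := (SimpleGraph.ConnectedComponent.exact h).exists_isPath
    refine ⟨p, hp, fun Q hQ hb => ?_⟩
    rw [← SimpleGraph.Walk.length_edges]
    refine hmin _ _ hp.isTrail.edges_nodup (fun e he => ?_) hQ (fun u => by rw [lb_edges, hb])
    have := SimpleGraph.Walk.edges_subset_edgeSet p he
    induction e with | _ a b
    exact FFadj this
  have R0 : ∀ x y, x ≠ y → c x = c y → G.Adj x y → s(x, y) ∈ F := by
    intro x y hxy hc hG
    obtain ⟨p, hp, hl⟩ := walk x y hc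
    have := hl [s(x, y)] (by simp [hG]) (fun u => by simp [lb_cons, lb_nil])
    match p, this with
    | .nil, _ => exact absurd rfl hxy
    | .cons h .nil, _ => exact FFadj h
    | .cons h (.cons h' q), this => simp at this
  have R1 : ∀ x ∈ N, c v ≠ c x := fun x hx h =>
    (hN x hx).2 (R0 v x (hN x hx).1.ne h (hN x hx).1)
  have R2 : ∀ x ∈ N, ∀ y ∈ N, x ≠ y → c x = c y → ¬ s(x, y) ∈ F →
      ∃ w, s(x, w) ∈ F ∧ s(w, y) ∈ F := by
    intro x hx y hy hxy hc hnF
    obtain ⟨p, hp, hl⟩ := walk x y hc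
    have := hl [s(x, v), s(v, y)] (by simp [(hN x hx).1.symm, (hN y hy).1])
      (fun u => by
        simp only [lb_cons, lb_nil]; linear_combination (if u = v then 1 else 0) * two)
    match p, this with
    | .nil, _ => exact absurd rfl hxy
    | .cons h .nil, _ => exact absurd (FFadj h) hnF
    | .cons h (.cons h' .nil), _ => exact ⟨_, FFadj h, FFadj h'⟩
    | .cons h (.cons h' (.cons h'' q)), this => simp at this
  have five : ∀ x ∈ N, ∀ y ∈ N, ∀ z ∈ N, x ≠ z → y ≠ z → c x = c z → c y = c z →
      s(x, y) ∈ F → s(x, z) ∉ F → s(y, z) ∉ F → False := by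
    intro x hx y hy z hz n2 n3 c1 c2 hxy hxz hyz
    obtain ⟨w, hw1, hw2⟩ := R2 x hx z hz n2 c1 hxz
    obtain ⟨w', hw1', hw2'⟩ := R2 y hy z hz n3 c2 hyz
    have n1 := Fne hxy
    by_cases hww : w = w'
    · subst hww
      exact path2 x w y hw1 (sw hw1') n1 (FG hxy)
    · exact path4 x w z w' y hw1 hw2 (sw hw2') (sw hw1') n2
        (fun h => hxz (h ▸ hw2')) n1 hww (fun h => hyz (h ▸ hw2)) n3.symm (FG hxy)
  have R3 : ∀ x ∈ N, ∀ y ∈ N, ∀ z ∈ N, x ≠ y → x ≠ z → y ≠ z → c x = c z → c y = c z →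
      (s(x, y) ∈ F ∧ s(y, z) ∈ F ∧ ¬ G.Adj x z) ∨ (s(y, x) ∈ F ∧ s(x, z) ∈ F ∧ ¬ G.Adj y z) ∨
      (s(x, z) ∈ F ∧ s(z, y) ∈ F ∧ ¬ G.Adj x y) := by
    intro x hx y hy z hz n1 n2 n3 c1 c2
    have c3 : c x = c y := c1.trans c2.symm
    have hcl := hclaw v x y z (hN x hx).1 (hN y hy).1 (hN z hz).1 n1 n2 n3
    have g1 := R0 x y n1 c3
    have g2 := R0 x z n2 c1
    have g3 := R0 y z n3 c2
    by_cases h1 : s(x, y) ∈ F <;> by_cases h2 : s(x, z) ∈ F <;> by_cases h3 : s(y, z) ∈ F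
    · exact (path2 x y z h1 h3 n2 (FG h2)).elim
    · exact Or.inr (Or.inl ⟨sw h1, h2, fun h => h3 (g3 h)⟩)
    · exact Or.inl ⟨h1, h3, fun h => h2 (g2 h)⟩
    · exact (five x hx y hy z hz n2 n3 c1 c2 h1 h2 h3).elim
    · exact Or.inr (Or.inr ⟨h2, sw h3, fun h => h1 (g1 h)⟩)
    · exact (five x hx z hz y hy n1 n3.symm c3 c2.symm h2 h1 (fun h => h3 (sw h))).elim
    · exact (five y hy z hz x hx n1.symm n2.symm c3.symm c1.symm h3 (fun h => h1 (sw h))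
        (fun h => h2 (sw h))).elim
    · exact (by tauto : False).elim
  have R3' : ∀ K : FF.ConnectedComponent, 2 < (N.filter (fun x => c x = K)).card →
      ∃ x ∈ N, ∃ y ∈ N, ∃ z ∈ N, c x = K ∧ c y = K ∧ c z = K ∧ x ≠ z ∧
        s(x, y) ∈ F ∧ s(y, z) ∈ F ∧ ¬ G.Adj x z := by
    intro K hK
    obtain ⟨x, hx, y, hy, z, hz, n1, n2, n3⟩ := Finset.two_lt_card.1 hK
    simp only [Finset.mem_filter] at hx hy hz
    rcases R3 x hx.1 y hy.1 z hz.1 n1 n2 n3 (hx.2.trans hz.2.symm) (hy.2.trans hz.2.symm) with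
      h | h | h
    · exact ⟨x, hx.1, y, hy.1, z, hz.1, hx.2, hy.2, hz.2, n2, h⟩
    · exact ⟨y, hy.1, x, hx.1, z, hz.1, hy.2, hx.2, hz.2, n3, h⟩
    · exact ⟨x, hx.1, z, hz.1, y, hy.1, hx.2, hz.2, hy.2, n1, h⟩
  have R4 : ∀ K : FF.ConnectedComponent, (N.filter (fun x => c x = K)).card ≤ 3 := by
    intro K
    by_contra hK
    obtain ⟨x, hx, y, hy, z, hz, cx, cy, cz, nxz, h1, h2, h3⟩ := R3' K (by omega)
    have hlt : ({x, y, z} : Finset V).card < (N.filter (fun x => c x = K)).card := by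
      have := Finset.card_le_three (a := x) (b := y) (c := z)
      omega
    obtain ⟨t, ht, ht'⟩ := Finset.exists_mem_notMem_of_card_lt_card hlt
    simp only [Finset.mem_filter] at ht
    simp only [Finset.mem_insert, Finset.mem_singleton, not_or] at ht'
    obtain ⟨tx, ty, tz⟩ := ht'
    rcases R3 x hx z hz t ht.1 nxz (Ne.symm tx) (Ne.symm tz) (cx.trans ht.2.symm)
      (cz.trans ht.2.symm) with h | h | h
    · exact h3 (FG h.1)
    · exact h3 (FG (sw h.1))
    · exact path3 x y z t h1 h2 (sw h.2.1) nxz (Ne.symm tx) (Ne.symm ty) (FG h.1)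
  have R5 : ∀ K K' : FF.ConnectedComponent, 2 < (N.filter (fun x => c x = K)).card →
      2 < (N.filter (fun x => c x = K')).card → K = K' := by
    intro K K' hK hK'
    by_contra hne
    obtain ⟨x, hx, y, hy, z, hz, cx, cy, cz, nxz, h1, h2, h3⟩ := R3' K hK
    obtain ⟨x', hx', y', hy', z', hz', cx', cy', cz', nxz', h1', h2', h3'⟩ := R3' K' hK'
    have dif : ∀ a b, c a = K → c b = K' → a ≠ b := fun a b ha hb hab =>
      hne (by rw [← ha, ← hb, hab])
    have fin : ∀ p q, c p = K' → c q = K' → G.Adj x p → G.Adj z q → s(p, y') ∈ F →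
        s(y', q) ∈ F → p ≠ q → False := by
      intro p q cp cq g1 g2 k1 k2 npq
      have n1 := Fne h1
      have n2 := Fne h2
      have n3 := Fne k1
      have n4 := Fne k2
      have d1 := dif x p cx cp
      have d2 := dif x y' cx cy'
      have d3 := dif x q cx cq
      have d4 := dif y p cy cp
      have d5 := dif y y' cy cy'
      have d6 := dif y q cy cq
      have d7 := dif z p cz cp
      have d8 := dif z y' cz cy'
      have d9 := dif z q cz cq
      have := hmin [s(x, y), s(y, z), s(p, y'), s(y', q)] [s(x, p), s(z, q)] (by clear two; simp; grind)
        (by simp [h1, h2, k1, k2]) (by simp [g1, g2])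
        (fun u => by
          simp only [lb_cons, lb_nil]
          linear_combination ((if u = y then 1 else 0) + (if u = y' then 1 else 0)) * two)
      simp at this
    have a1 := hclaw v x z x' (hN x hx).1 (hN z hz).1 (hN x' hx').1 nxz
      (dif _ _ cx cx') (dif _ _ cz cx')
    have a2 := hclaw v x z z' (hN x hx).1 (hN z hz).1 (hN z' hz').1 nxz
      (dif _ _ cx cz') (dif _ _ cz cz')
    have a3 := hclaw v x x' z' (hN x hx).1 (hN x' hx').1 (hN z' hz').1
      (dif _ _ cx cx') (dif _ _ cx cz') nxz'
    have a4 := hclaw v z x' z' (hN z hz).1 (hN x' hx').1 (hN z' hz').1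
      (dif _ _ cz cx') (dif _ _ cz cz') nxz'
    have f1 : G.Adj x x' → G.Adj z z' → False := fun g g' =>
      fin x' z' cx' cz' g g' h1' h2' nxz'
    have f2 : G.Adj x z' → G.Adj z x' → False := fun g g' =>
      fin z' x' cz' cx' g g' (sw h2') (sw h1') nxz'.symm
    tauto
  -- counting
  have hsum : N.card ≤ 2 * (N.image c).card + 1 := by
    rw [Finset.card_eq_sum_card_image c N]
    have h1 : ∀ K ∈ N.image c, (N.filter (fun x => c x = K)).card ≤
        2 + (if 2 < (N.filter (fun x => c x = K)).card then 1 else 0) := by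
      intro K _
      have := R4 K
      split_ifs <;> omega
    refine (Finset.sum_le_sum h1).trans ?_
    rw [Finset.sum_add_distrib, Finset.sum_const, smul_eq_mul, Finset.sum_boole, Nat.cast_id]
    have : ((N.image c).filter (fun K => 2 < (N.filter (fun x => c x = K)).card)).card ≤ 1 := by
      rw [Finset.card_le_one]
      intro a ha b hb
      simp only [Finset.mem_filter] at ha hb
      exact R5 a b ha.2 hb.2
    omega
  obtain ⟨r, hout⟩ : ∃ r : FF.ConnectedComponent → V, ∀ K, c (r K) = K :=
    ⟨Quot.out, fun K => Quot.out_eq K⟩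
  have hcount := forest_count F (fun P hP hPF hb => by
      simpa using hmin P [] hP hPF (by simp) (fun u => by rw [hb u, lb_nil])) c hcF
    ((insert (c v) (N.image c)).image r) (by
      intro a ha b hb hab
      obtain ⟨K, -, rfl⟩ := Finset.mem_image.1 ha
      obtain ⟨L, -, rfl⟩ := Finset.mem_image.1 hb
      rw [hout, hout] at hab
      rw [hab])
  rw [Finset.card_image_of_injective _ (fun K L h => by rw [← hout K, ← hout L, h]),
    Finset.card_insert_of_notMem (by
      intro h
      obtain ⟨x, hx, hxv⟩ := Finset.mem_image.1 h
      exact R1 x hx hxv.symm)] at hcount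
  obtain ⟨m, hm⟩ := hev
  omega

/-- If `G` is a claw-free simple graph on `n` vertices (no induced
`K_{1,3}`), then `E(G)` can be partitioned into at most `n - 1` parts, each of which is
either the edge set of a `2`-regular subgraph of `G` or a single edge. -/
theorem claw_free_two_regular_decomposition
    {V : Type*} [Fintype V] [DecidableEq V] (G : SimpleGraph V)
    (hclaw : ∀ v a b c : V, G.Adj v a → G.Adj v b → G.Adj v c →
      a ≠ b → a ≠ c → b ≠ c → (G.Adj a b ∨ G.Adj a c ∨ G.Adj b c)) :
    ∃ (k : ℕ) (f : Fin k → Set (Sym2 V)),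
      k ≤ Fintype.card V - 1 ∧
      (∀ i, IsTwoRegularEdgeSet G (f i) ∨ ∃ e ∈ G.edgeSet, f i = {e}) ∧
      (∀ i j, i ≠ j → Disjoint (f i) (f j)) ∧
      (∀ e, e ∈ G.edgeSet ↔ ∃ i, e ∈ f i) := by
  classical
  rcases isEmpty_or_nonempty V with hV | hV
  · refine ⟨0, fun i => i.elim0, Nat.zero_le _, fun i => i.elim0, fun i => i.elim0, fun e => ?_⟩
    induction e with | _ a b
    exact (hV.false a).elim
  obtain ⟨F, hFE, hb, hmin⟩ := exists_min G.edgeFinset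
  have hF : ∀ e ∈ F, e ∈ G.edgeSet := fun e he => by simpa using hFE he
  have hd : ∀ a, s(a, a) ∉ G.edgeFinset \ F := fun a h => by
    have := (Finset.mem_sdiff.1 h).1
    simp at this
  have hineq : ∀ v, F.card + (∑ e ∈ G.edgeFinset \ F, cnt v e) / 2 + 1 ≤ Fintype.card V ∧
      Even (∑ e ∈ G.edgeFinset \ F, cnt v e) := by
    intro v
    have hev : Even (∑ e ∈ G.edgeFinset \ F, cnt v e) := by
      rw [← ZMod.natCast_eq_zero_iff_even]
      have := hb v
      rw [bd] at this
      rw [Nat.cast_sum]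
      exact this
    refine ⟨?_, hev⟩
    rw [deg_eq _ hd] at hev ⊢
    refine key_ineq G hclaw F hF (fun P Q h1 h2 h3 h4 => hmin P Q h1 h2
      (fun e he => by simpa using h3 e he) h4) v _ ?_ hev
    intro x hx
    simpa using hx
  obtain ⟨v₀⟩ := id hV
  have h0 := (hineq v₀).1
  obtain ⟨g, hg1, hg2, hg3⟩ := even_decomp G (G.edgeFinset \ F)
    (fun e he => by simpa using (Finset.mem_sdiff.1 he).1) hb (Fintype.card V - 1 - F.card)
    (fun u => by
      obtain ⟨h1, m, hm⟩ := hineq u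
      omega)
  let φ : Fin (Fintype.card V - 1 - F.card) ⊕ F → Set (Sym2 V) :=
    Sum.elim g (fun e => {(e : Sym2 V)})
  let eqv := Fintype.equivFin (Fin (Fintype.card V - 1 - F.card) ⊕ F)
  refine ⟨_, φ ∘ eqv.symm, ?_, ?_, ?_, ?_⟩
  · simp only [Fintype.card_sum, Fintype.card_fin, Fintype.card_coe]
    omega
  · intro i
    simp only [Function.comp]
    rcases eqv.symm i with j | e
    · exact Or.inl (hg1 j)
    · exact Or.inr ⟨e, hF _ e.2, rfl⟩
  · have hφ : ∀ a b, a ≠ b → Disjoint (φ a) (φ b) := by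
      have hm : ∀ j (e : F), (e : Sym2 V) ∉ g j := fun j e he =>
        (Finset.mem_sdiff.1 ((hg3 e).2 ⟨j, he⟩)).2 e.2
      rintro (j | e) (j' | e') hne
      · exact hg2 j j' (fun h => hne (by rw [h]))
      · simpa [φ] using hm j e'
      · simpa [φ] using hm j' e
      · simp only [φ, Sum.elim_inr, Set.disjoint_singleton]
        exact fun h => hne (by rw [Subtype.ext h])
    intro i j hij
    exact hφ _ _ (fun h => hij (eqv.symm.injective h))
  · intro e
    have : (∃ i, e ∈ (φ ∘ eqv.symm) i) ↔ ∃ a, e ∈ φ a :=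
      ⟨fun ⟨i, h⟩ => ⟨_, h⟩, fun ⟨a, h⟩ => ⟨eqv a, by simpa using h⟩⟩
    rw [this]
    constructor
    · intro he
      by_cases h : e ∈ F
      · exact ⟨Sum.inr ⟨e, h⟩, rfl⟩
      · obtain ⟨i, hi⟩ := (hg3 e).1 (Finset.mem_sdiff.2 ⟨by simpa using he, h⟩)
        exact ⟨Sum.inl i, hi⟩
    · rintro ⟨j | f, h⟩
      · simpa using (Finset.mem_sdiff.1 ((hg3 e).2 ⟨j, h⟩)).1
      · have : e = f := h
        rw [this]
        exact hF _ f.2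
end
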